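/- arXiv:math/0609605 — 9 statements merged into one kernel-verified Lean document; each statement's English description precedes it below -/
import Mathlib

section
/- Let λ < ρ be real numbers and let G : [λ, ρ] → ℝ be Lipschitz continuous. Then there exists a nondecreasing function h : ℝ → [λ, ρ] such that for all but countably many v ∈ ℝ the function α ↦ G(α) − vα has a unique global minimizer on [λ, ρ] equal to h(v); and for any such h, the function u : ℝ × (0, ∞) → [λ, ρ] defined by u(x, t) := h(x/t) is an entropy solution of ∂_t u + ∂_x G(u) = 0 on ℝ × (0, ∞), and moreover for every bounded interval I ⊂ ℝ, ∫_I |u(x, t) − u₀(x)| dx → 0 as t → 0⁺, where u₀(x) = λ for x < 0 and u₀(x) = ρ for x ≥ 0. -/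
open MeasureTheory Set Filter

/-- Kružkov entropy solution of `∂ₜ u + ∂ₓ G(u) = 0` on `ℝ × (0, ∞)`, with Kružkov
constants `c` ranging in `[lam, rho]`: for every nonnegative smooth compactly supported
test function `φ` whose support is contained in `ℝ × (0, ∞)`,
`∫∫ (|u − c| ∂ₜφ + sgn(u − c)(G(u) − G(c)) ∂ₓφ) ≥ 0`. -/
def IsEntropySolution (lam rho : ℝ) (G : ℝ → ℝ) (u : ℝ → ℝ → ℝ) : Prop :=
  ∀ c ∈ Set.Icc lam rho, ∀ φ : ℝ → ℝ → ℝ,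
    ContDiff ℝ (⊤ : ℕ∞) (fun p : ℝ × ℝ => φ p.1 p.2) →
    HasCompactSupport (fun p : ℝ × ℝ => φ p.1 p.2) →
    (∀ x t : ℝ, t ≤ 0 → φ x t = 0) →
    (∀ x t : ℝ, 0 ≤ φ x t) →
    0 ≤ ∫ t in Set.Ioi (0 : ℝ), ∫ x : ℝ,
      (|u x t - c| * deriv (fun s => φ x s) t +
        Real.sign (u x t - c) * (G (u x t) - G c) * deriv (fun y => φ y t) x)

/-- `h : ℝ → [lam, rho]` is nondecreasing and, for all but countably many `v ∈ ℝ`,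
`h v` is the unique global minimizer of `α ↦ G α − v α` on `[lam, rho]`. -/
def IsVariationalMinimizer (lam rho : ℝ) (G : ℝ → ℝ) (h : ℝ → ℝ) : Prop :=
  Monotone h ∧ (∀ v : ℝ, h v ∈ Set.Icc lam rho) ∧
  ∃ S : Set ℝ, S.Countable ∧ ∀ v ∉ S,
    ∀ α ∈ Set.Icc lam rho, α ≠ h v → G (h v) - v * h v < G α - v * α

theorem exists_isVariationalMinimizer {lam rho : ℝ} (hlr : lam ≤ rho) {G : ℝ → ℝ}
    (hG : ContinuousOn G (Icc lam rho)) : ∃ h : ℝ → ℝ, IsVariationalMinimizer lam rho G h := by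
  have hmin : ∀ v : ℝ, ∃ a ∈ Icc lam rho, ∀ b ∈ Icc lam rho, G a - v * a ≤ G b - v * b :=
    fun v => isCompact_Icc.exists_isMinOn (nonempty_Icc.2 hlr)
      (hG.sub (continuous_const.mul continuous_id).continuousOn)
  have key : ∀ v w a b : ℝ, v < w → a ∈ Icc lam rho → b ∈ Icc lam rho →
      (∀ x ∈ Icc lam rho, G a - v * a ≤ G x - v * x) →
      (∀ x ∈ Icc lam rho, G b - w * b ≤ G x - w * x) → a ≤ b := by
    intro v w a b hvw ha hb ha' hb'
    by_contra! hab
    nlinarith [ha' b hb, hb' a ha, mul_pos (sub_pos.2 hvw) (sub_pos.2 hab)]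
  choose h hI hh using hmin
  have hm : Monotone h := fun v w hvw => by
    rcases hvw.eq_or_lt with rfl | hlt
    · exact le_rfl
    · exact key v w _ _ hlt (hI v) (hI w) (hh v) (hh w)
  refine ⟨h, hm, hI, {v | ¬ ContinuousAt h v}, hm.countable_not_continuousAt, ?_⟩
  intro v hv α hα hne
  have hc : ContinuousAt h v := by simpa using hv
  by_contra! hle
  have hα' : ∀ x ∈ Icc lam rho, G α - v * α ≤ G x - v * x :=
    fun x hx => hle.trans (hh v x hx)
  rcases lt_or_gt_of_ne hne with hlt | hgt
  · have h1 : ∀ᶠ w in nhdsWithin v (Iio v), α < h w :=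
      (hc.tendsto.mono_left nhdsWithin_le_nhds).eventually (lt_mem_nhds hlt)
    obtain ⟨w, hw, hwv⟩ := (h1.and self_mem_nhdsWithin).exists
    exact absurd (key w v _ _ hwv (hI w) hα (hh w) hα') (not_le.2 hw)
  · have h1 : ∀ᶠ w in nhdsWithin v (Ioi v), h w < α :=
      (hc.tendsto.mono_left nhdsWithin_le_nhds).eventually (gt_mem_nhds hgt)
    obtain ⟨w, hw, hwv⟩ := (h1.and self_mem_nhdsWithin).exists
    exact absurd (key v w _ _ hwv hα (hI w) hα' (hh w)) (not_le.2 hw)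

theorem IsVariationalMinimizer.exists_le_sub {lam rho : ℝ} {G h : ℝ → ℝ}
    (hh : IsVariationalMinimizer lam rho G h) :
    ∃ S : Set ℝ, S.Countable ∧ ∀ v ∉ S, ∀ α ∈ Icc lam rho, G (h v) - v * h v ≤ G α - v * α := by
  obtain ⟨-, -, S, hS, hmin⟩ := hh
  refine ⟨S, hS, fun v hv α hα => ?_⟩
  by_cases hne : α = h v
  · rw [hne]
  · exact (hmin v hv α hα hne).le

theorem Set.Countable.exists_gt_notMem {S : Set ℝ} (hS : S.Countable) (a : ℝ) :
    ∃ v, a < v ∧ v ∉ S := by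
  obtain ⟨v, hv, hav⟩ := hS.dense_compl ℝ |>.exists_gt a
  exact ⟨v, hav, hv⟩

theorem Set.Countable.exists_lt_notMem {S : Set ℝ} (hS : S.Countable) (a : ℝ) :
    ∃ v, v < a ∧ v ∉ S := by
  obtain ⟨v, hv, hav⟩ := hS.dense_compl ℝ |>.exists_lt a
  exact ⟨v, hav, hv⟩

theorem IsVariationalMinimizer.eventually_atTop_eq {lam rho : ℝ} {G h : ℝ → ℝ} {L : NNReal}
    (hlr : lam ≤ rho) (hG : LipschitzOnWith L G (Icc lam rho))
    (hh : IsVariationalMinimizer lam rho G h) : ∀ᶠ v in atTop, h v = rho := by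
  obtain ⟨S, hS, hmin⟩ := hh.exists_le_sub
  obtain ⟨w, hLw, hwS⟩ := hS.exists_gt_notMem (L : ℝ)
  have hIw := hh.2.1 w
  have hw : rho ≤ h w := by
    have h1 := hmin w hwS rho (right_mem_Icc.2 hlr)
    have h2 := hG.dist_le_mul rho (right_mem_Icc.2 hlr) (h w) hIw
    rw [Real.dist_eq, Real.dist_eq, abs_of_nonneg (sub_nonneg.2 hIw.2)] at h2
    by_contra! hlt
    nlinarith [le_abs_self (G rho - G (h w)), mul_pos (sub_pos.2 hLw) (sub_pos.2 hlt)]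
  filter_upwards [eventually_ge_atTop w] with v hv
  exact le_antisymm (hh.2.1 v).2 (hw.trans (hh.1 hv))

theorem IsVariationalMinimizer.eventually_atBot_eq {lam rho : ℝ} {G h : ℝ → ℝ} {L : NNReal}
    (hlr : lam ≤ rho) (hG : LipschitzOnWith L G (Icc lam rho))
    (hh : IsVariationalMinimizer lam rho G h) : ∀ᶠ v in atBot, h v = lam := by
  obtain ⟨S, hS, hmin⟩ := hh.exists_le_sub
  obtain ⟨w, hLw, hwS⟩ := hS.exists_lt_notMem (-L : ℝ)
  have hIw := hh.2.1 w
  have hw : h w ≤ lam := by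
    have h1 := hmin w hwS lam (left_mem_Icc.2 hlr)
    have h2 := hG.dist_le_mul (h w) hIw lam (left_mem_Icc.2 hlr)
    rw [Real.dist_eq, Real.dist_eq, abs_of_nonneg (sub_nonneg.2 hIw.1)] at h2
    by_contra! hlt
    nlinarith [neg_abs_le (G (h w) - G lam), mul_pos (sub_pos.2 hLw) (sub_pos.2 hlt)]
  filter_upwards [eventually_le_atBot w] with v hv
  exact le_antisymm ((hh.1 hv).trans hw) (hh.2.1 v).1

theorem IsVariationalMinimizer.tendsto_initial {lam rho : ℝ} {G h : ℝ → ℝ} {L : NNReal}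
    (hlr : lam ≤ rho) (hG : LipschitzOnWith L G (Icc lam rho))
    (hh : IsVariationalMinimizer lam rho G h) (A B : ℝ) :
    Tendsto (fun t => ∫ x in Icc A B, |h (x / t) - (if x < 0 then lam else rho)|)
      (nhdsWithin 0 (Ioi 0)) (nhds 0) := by
  have hmeas : Measurable h := hh.1.measurable
  suffices H : Tendsto (fun t => ∫ x in Icc A B, |h (x / t) - (if x < 0 then lam else rho)|)
      (nhdsWithin 0 (Ioi 0)) (nhds (∫ _ in Icc A B, (0 : ℝ))) by
    rwa [integral_zero] at H
  refine tendsto_integral_filter_of_dominated_convergence (fun _ => rho - lam) ?_ ?_ ?_ ?_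
  · refine Eventually.of_forall fun t => Measurable.aestronglyMeasurable ?_
    exact ((hmeas.comp (measurable_id.div_const t)).sub
      (Measurable.ite measurableSet_Iio measurable_const measurable_const)).abs
  · refine Eventually.of_forall fun t => Eventually.of_forall fun x => ?_
    have hI := hh.2.1 (x / t)
    rw [Real.norm_eq_abs, abs_abs, abs_le]
    split_ifs <;> constructor <;> linarith [hI.1, hI.2]
  · exact integrable_const _
  · have h0 : ∀ᵐ x ∂(volume.restrict (Icc A B)), x ≠ (0 : ℝ) :=
      ae_restrict_of_ae (Measure.ae_ne volume 0)
    filter_upwards [h0] with x hx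
    refine tendsto_const_nhds.congr' ?_
    rcases lt_or_gt_of_ne hx with hneg | hpos
    · have hlim : Tendsto (fun t : ℝ => x / t) (nhdsWithin 0 (Ioi 0)) atBot := by
        simp only [div_eq_mul_inv]
        exact tendsto_inv_nhdsGT_zero.const_mul_atTop_of_neg hneg
      filter_upwards [hlim.eventually (hh.eventually_atBot_eq hlr hG)] with t ht
      simp [ht, hneg]
    · have hlim : Tendsto (fun t : ℝ => x / t) (nhdsWithin 0 (Ioi 0)) atTop := by
        simp only [div_eq_mul_inv]
        exact tendsto_inv_nhdsGT_zero.const_mul_atTop hpos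
      filter_upwards [hlim.eventually (hh.eventually_atTop_eq hlr hG)] with t ht
      simp [ht, not_lt.2 hpos.le]

theorem HasCompactSupport.hasDerivAt_integral_mul_comp_sub {f ψ : ℝ → ℝ}
    (hf : LocallyIntegrable f) (hψ : ContDiff ℝ 1 ψ) (hc : HasCompactSupport ψ) :
    HasDerivAt (fun s => ∫ v, f v * ψ (v - s)) (-∫ v, f v * deriv ψ v) 0 := by
  have h1 : ContDiff ℝ 1 fun s => ψ (-s) := hψ.comp contDiff_neg
  have h2 : HasCompactSupport fun s => ψ (-s) :=
    hc.comp_homeomorph (Homeomorph.neg ℝ)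
  have h3 := h2.hasDerivAt_convolution_right (μ := volume) (ContinuousLinearMap.mul ℝ ℝ) hf h1 0
  convert! h3 using 1
  · funext s
    simp [MeasureTheory.convolution]
  · simp [MeasureTheory.convolution, deriv_comp_neg, integral_neg]

/-- An upper bound on backward difference quotients of `f` is inherited by its distributional
derivative. -/
theorem integral_mul_le_integral_mul_deriv {f g ψ : ℝ → ℝ} {m : ℕ → ℝ → ℝ} {ε : ℕ → ℝ} {C : ℝ}
    (hf : LocallyIntegrable f) (hψ : ContDiff ℝ 1 ψ) (hc : HasCompactSupport ψ)
    (hψ0 : ∀ v, 0 ≤ ψ v) (hε : ∀ n, 0 < ε n) (hε0 : Tendsto ε atTop (nhds 0))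
    (hm : ∀ n, Measurable (m n)) (hmC : ∀ n v, |m n v| ≤ C)
    (hmg : ∀ᵐ v, Tendsto (fun n => m n v) atTop (nhds (g v)))
    (hfm : ∀ n, ∀ᵐ v, ε n * m n v ≤ f (v - ε n) - f v) :
    ∫ v, g v * ψ v ≤ ∫ v, f v * deriv ψ v := by
  have hψi : Integrable ψ := hψ.continuous.integrable_of_hasCompactSupport hc
  have hI : ∀ s, Integrable fun v => f v * ψ (v - s) := fun s =>
    hf.integrable_smul_right_of_hasCompactSupport (hψ.continuous.comp (continuous_sub_right s))
      (hc.comp_homeomorph (Homeomorph.subRight s))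
  have hlim1 : Tendsto (fun n => ∫ v, m n v * ψ v) atTop (nhds (∫ v, g v * ψ v)) := by
    refine tendsto_integral_of_dominated_convergence (fun v => C * ψ v) (fun n => ?_)
      (hψi.const_mul C) (fun n => Eventually.of_forall fun v => ?_) ?_
    · exact ((hm n).mul hψ.continuous.measurable).aestronglyMeasurable
    · rw [Real.norm_eq_abs, abs_mul, abs_of_nonneg (hψ0 v)]
      exact mul_le_mul_of_nonneg_right (hmC n v) (hψ0 v)
    · filter_upwards [hmg] with v hv using hv.mul_const _
  have hneg : Tendsto (fun n => -ε n) atTop (nhdsWithin 0 {0}ᶜ) := by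
    refine tendsto_nhdsWithin_iff.2 ⟨by simpa using hε0.neg, Eventually.of_forall fun n => ?_⟩
    simpa using (hε n).ne'
  have hlim2 := ((hasDerivAt_iff_tendsto_slope.1
    (hc.hasDerivAt_integral_mul_comp_sub hf hψ)).comp hneg).neg
  rw [neg_neg] at hlim2
  refine le_of_tendsto_of_tendsto' hlim1 hlim2 fun n => ?_
  have hshift : ∫ v, f v * ψ (v - -ε n) = ∫ v, f (v - ε n) * ψ v := by
    rw [← integral_sub_right_eq_self (fun v => f v * ψ (v - -ε n)) (ε n)]
    simp
  have hIs : Integrable fun v => f (v - ε n) * ψ v := by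
    simpa using (hI (-ε n)).comp_sub_right (ε n)
  have hI0 : Integrable fun v => f v * ψ v := by simpa using hI 0
  have hmi : Integrable fun v => m n v * ψ v :=
    hψi.bdd_mul (hm n).aestronglyMeasurable (Eventually.of_forall (hmC n))
  have hle : ε n * ∫ v, m n v * ψ v ≤ (∫ v, f (v - ε n) * ψ v) - ∫ v, f v * ψ v := by
    rw [← integral_sub hIs hI0, ← integral_const_mul]
    refine integral_mono_ae (hmi.const_mul _) (hIs.sub hI0) ?_
    filter_upwards [hfm n] with v hv
    have := mul_le_mul_of_nonneg_right hv (hψ0 v)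
    linarith
  have hsl : -slope (fun s => ∫ v, f v * ψ (v - s)) 0 (-ε n)
      = ((∫ v, f (v - ε n) * ψ v) - ∫ v, f v * ψ v) / ε n := by
    rw [slope_def_field, hshift]
    simp only [sub_zero]
    rw [div_neg, neg_neg]
  simp only [Function.comp_apply]
  rw [hsl, le_div_iff₀ (hε n)]
  linarith

/-- The Kružkov entropy flux of `∂ₜ u + ∂ₓ G(u) = 0` paired with the entropy `|u - c|`. -/
noncomputable def kruzkovFlux (G : ℝ → ℝ) (c a : ℝ) : ℝ := Real.sign (a - c) * (G a - G c)

theorem kruzkovFlux_of_le {G : ℝ → ℝ} {c a : ℝ} (h : c ≤ a) : kruzkovFlux G c a = G a - G c := by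
  rcases h.eq_or_lt with rfl | hlt
  · simp [kruzkovFlux]
  · simp [kruzkovFlux, Real.sign_of_pos (sub_pos.2 hlt)]

theorem kruzkovFlux_of_ge {G : ℝ → ℝ} {c a : ℝ} (h : a ≤ c) :
    kruzkovFlux G c a = -(G a - G c) := by
  rcases h.eq_or_lt with rfl | hlt
  · simp [kruzkovFlux]
  · simp [kruzkovFlux, Real.sign_of_neg (sub_neg.2 hlt)]

theorem abs_kruzkovFlux (G : ℝ → ℝ) (c a : ℝ) : |kruzkovFlux G c a| = |G a - G c| := by
  rcases le_total c a with h | h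
  · rw [kruzkovFlux_of_le h]
  · rw [kruzkovFlux_of_ge h, abs_neg]

theorem measurable_kruzkovFlux_comp {G h : ℝ → ℝ} (c : ℝ) (hh : Measurable h)
    (hGh : Measurable fun v => G (h v)) : Measurable fun v => kruzkovFlux G c (h v) := by
  have : (fun v => kruzkovFlux G c (h v)) =
      fun v => if h v ≤ c then -(G (h v) - G c) else G (h v) - G c := by
    funext v
    split_ifs with hv
    · exact kruzkovFlux_of_ge hv
    · exact kruzkovFlux_of_le (not_le.1 hv).le
  rw [this]
  exact Measurable.ite (measurableSet_le hh measurable_const) (hGh.sub_const _).neg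
    (hGh.sub_const _)

theorem kruzkov_backward_difference_le {G : ℝ → ℝ} {v w a b c : ℝ} (hba : b ≤ a)
    (hab : G a - v * a ≤ G b - v * b) (hac : G a - v * a ≤ G c - v * c)
    (hb_a : G b - w * b ≤ G a - w * a) (hbc : G b - w * b ≤ G c - w * c) :
    (v - w) * (max (b - c) 0 + max (c - a) 0) ≤
      (kruzkovFlux G c b - w * |b - c|) - (kruzkovFlux G c a - v * |a - c|) := by
  rcases le_total c b with h1 | h1
  · have h2 : c ≤ a := h1.trans hba
    rw [kruzkovFlux_of_le h1, kruzkovFlux_of_le h2, abs_of_nonneg (sub_nonneg.2 h1),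
      abs_of_nonneg (sub_nonneg.2 h2), max_eq_left (sub_nonneg.2 h1),
      max_eq_right (sub_nonpos.2 h2)]
    linarith
  · rcases le_total c a with h2 | h2
    · rw [kruzkovFlux_of_ge h1, kruzkovFlux_of_le h2, abs_of_nonpos (sub_nonpos.2 h1),
        abs_of_nonneg (sub_nonneg.2 h2), max_eq_right (sub_nonpos.2 h1),
        max_eq_right (sub_nonpos.2 h2)]
      linarith
    · rw [kruzkovFlux_of_ge h1, kruzkovFlux_of_ge h2, abs_of_nonpos (sub_nonpos.2 h1),
        abs_of_nonpos (sub_nonpos.2 h2), max_eq_right (sub_nonpos.2 h1),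
        max_eq_left (sub_nonneg.2 h2)]
      linarith

theorem Measurable.locallyIntegrable_of_abs_le {f g : ℝ → ℝ} (hf : Measurable f)
    (hg : Continuous g) (hfg : ∀ v, |f v| ≤ g v) : LocallyIntegrable f :=
  hg.locallyIntegrable.mono hf.aestronglyMeasurable
    (Eventually.of_forall fun v => (hfg v).trans (le_abs_self _))

theorem IsVariationalMinimizer.measurable_comp {lam rho : ℝ} {G h : ℝ → ℝ} {L : NNReal}
    (hG : LipschitzOnWith L G (Icc lam rho)) (hh : IsVariationalMinimizer lam rho G h) :
    Measurable fun v => G (h v) := by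
  obtain ⟨G', hG', heq⟩ := hG.extend_real
  have : (fun v => G (h v)) = G' ∘ h := funext fun v => heq (hh.2.1 v)
  rw [this]
  exact hG'.continuous.measurable.comp hh.1.measurable

theorem IsVariationalMinimizer.abs_sub_le {lam rho c : ℝ} {G h : ℝ → ℝ}
    (hh : IsVariationalMinimizer lam rho G h) (hc : c ∈ Icc lam rho) (v : ℝ) :
    |h v - c| ≤ rho - lam := by
  have := hh.2.1 v
  rw [abs_le]
  constructor <;> linarith [this.1, this.2, hc.1, hc.2]

theorem IsVariationalMinimizer.abs_kruzkovFlux_le {lam rho c : ℝ} {G h : ℝ → ℝ} {L : NNReal}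
    (hG : LipschitzOnWith L G (Icc lam rho)) (hh : IsVariationalMinimizer lam rho G h)
    (hc : c ∈ Icc lam rho) (v : ℝ) : |kruzkovFlux G c (h v)| ≤ L * (rho - lam) := by
  rw [abs_kruzkovFlux]
  have := hG.dist_le_mul _ (hh.2.1 v) c hc
  rw [Real.dist_eq, Real.dist_eq] at this
  exact this.trans (mul_le_mul_of_nonneg_left (hh.abs_sub_le hc v) L.2)

theorem IsVariationalMinimizer.integral_mul_le {lam rho c : ℝ} {G h ψ : ℝ → ℝ} {L : NNReal}
    (hG : LipschitzOnWith L G (Icc lam rho)) (hh : IsVariationalMinimizer lam rho G h)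
    (hc : c ∈ Icc lam rho) (hψ : ContDiff ℝ 1 ψ) (hψc : HasCompactSupport ψ)
    (hψ0 : ∀ v, 0 ≤ ψ v) :
    ∫ v, |h v - c| * ψ v ≤ ∫ v, (kruzkovFlux G c (h v) - v * |h v - c|) * deriv ψ v := by
  have hmeas : Measurable h := hh.1.measurable
  have hq := measurable_kruzkovFlux_comp c hmeas (hh.measurable_comp hG)
  obtain ⟨S, hS, hmin⟩ := hh.exists_le_sub
  have hpos : ∀ n : ℕ, (0 : ℝ) < 1 / ((n : ℝ) + 1) := fun n => Nat.one_div_pos_of_nat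
  refine integral_mul_le_integral_mul_deriv (ε := fun n : ℕ => 1 / ((n : ℝ) + 1))
    (m := fun n v => max (h (v - 1 / ((n : ℝ) + 1)) - c) 0 + max (c - h v) 0)
    (C := (rho - lam) + (rho - lam)) ?_ hψ hψc hψ0 hpos tendsto_one_div_add_atTop_nhds_zero_nat
    ?_ ?_ ?_ ?_
  · refine Measurable.locallyIntegrable_of_abs_le
      (g := fun v => L * (rho - lam) + |v| * (rho - lam))
      (hq.sub (measurable_id.mul (hmeas.sub_const c).abs)) (by fun_prop) fun v => ?_
    refine (abs_sub _ _).trans (add_le_add (hh.abs_kruzkovFlux_le hG hc v) ?_)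
    rw [abs_mul, abs_abs]
    exact mul_le_mul_of_nonneg_left (hh.abs_sub_le hc v) (abs_nonneg v)
  · intro n
    exact (((hmeas.comp (measurable_id.sub_const _)).sub_const c).max measurable_const).add
      ((measurable_const.sub hmeas).max measurable_const)
  · intro n v
    have h1 := abs_le.1 (hh.abs_sub_le hc (v - 1 / ((n : ℝ) + 1)))
    have h2 := abs_le.1 (hh.abs_sub_le hc v)
    have h0 : 0 ≤ rho - lam := sub_nonneg.2 (hc.1.trans hc.2)
    rw [abs_of_nonneg (by positivity)]
    exact add_le_add (max_le h1.2 h0) (max_le (by linarith [h2.1]) h0)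
  · filter_upwards [hh.1.countable_not_continuousAt.ae_notMem volume] with v hv
    have hcont : ContinuousAt h v := by simpa using hv
    have hlim : Tendsto (fun n : ℕ => v - 1 / ((n : ℝ) + 1)) atTop (nhds v) := by
      simpa using (tendsto_const_nhds (x := v)).sub
        (tendsto_one_div_add_atTop_nhds_zero_nat (𝕜 := ℝ))
    have h1 := (((hcont.tendsto.comp hlim).sub_const c).max
      (tendsto_const_nhds (x := (0 : ℝ)))).add_const (max (c - h v) 0)
    have h2 : |h v - c| = max (h v - c) 0 + max (c - h v) 0 := by
      rcases le_total c (h v) with h | h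
      · rw [abs_of_nonneg (sub_nonneg.2 h), max_eq_left (sub_nonneg.2 h),
          max_eq_right (sub_nonpos.2 h), add_zero]
      · rw [abs_of_nonpos (sub_nonpos.2 h), max_eq_right (sub_nonpos.2 h),
          max_eq_left (sub_nonneg.2 h), zero_add, neg_sub]
    rw [h2]
    exact h1
  · intro n
    have hS' : ∀ᵐ v : ℝ, v - 1 / ((n : ℝ) + 1) ∉ S :=
      (measurePreserving_sub_right volume (1 / ((n : ℝ) + 1))).quasiMeasurePreserving.ae
        (hS.ae_notMem volume)
    filter_upwards [hS.ae_notMem volume, hS'] with v hv hw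
    have hwv : v - 1 / ((n : ℝ) + 1) ≤ v := by linarith [hpos n]
    have := kruzkov_backward_difference_le (hh.1 hwv) (hmin v hv _ (hh.2.1 _))
      (hmin v hv c hc) (hmin _ hw _ (hh.2.1 _)) (hmin _ hw c hc)
    rwa [sub_sub_cancel] at this

section SelfSimilar

variable {Φ : ℝ × ℝ → ℝ}

theorem hasDerivAt_comp_ray_left (hΦ : Differentiable ℝ Φ) (v t : ℝ) :
    HasDerivAt (fun v => Φ (v * t, t)) (t * fderiv ℝ Φ (v * t, t) (1, 0)) v := by
  have h1 : HasDerivAt (fun v : ℝ => (v * t, t)) (t, 0) v := by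
    simpa using ((hasDerivAt_id v).mul_const t).prodMk (hasDerivAt_const v t)
  have h2 := (hΦ (v * t, t)).hasFDerivAt.comp_hasDerivAt v h1
  have h3 : ((t, 0) : ℝ × ℝ) = t • ((1, 0) : ℝ × ℝ) := by simp
  rw [h3, map_smul, smul_eq_mul] at h2
  exact h2

theorem hasDerivAt_comp_ray_right (hΦ : Differentiable ℝ Φ) (v t : ℝ) :
    HasDerivAt (fun t => Φ (v * t, t)) (fderiv ℝ Φ (v * t, t) (v, 1)) t := by
  have h1 : HasDerivAt (fun t : ℝ => (v * t, t)) (v, 1) t := by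
    simpa using ((hasDerivAt_id t).const_mul v).prodMk (hasDerivAt_id t)
  exact HasFDerivAt.comp_hasDerivAt (f := fun t => (v * t, t)) t (hΦ (v * t, t)).hasFDerivAt h1

theorem HasCompactSupport.comp_ray {E : Type*} [Zero E] {F : ℝ × ℝ → E}
    (hF : HasCompactSupport F) {t : ℝ} (ht : t ≠ 0) :
    HasCompactSupport fun v => F (v * t, t) := by
  refine HasCompactSupport.intro (hF.isCompact.image (continuous_fst.div_const t)) fun v hv => ?_
  exact image_eq_zero_of_notMem_tsupport fun hmem => hv ⟨_, hmem, mul_div_cancel_right₀ v ht⟩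

theorem integral_comp_div_mul (η : ℝ → ℝ) {t : ℝ} (ht : 0 < t) :
    ∫ x, η (x / t) * Φ (x, t) = t * ∫ v, η v * Φ (v * t, t) := by
  rw [← smul_eq_mul, ← abs_of_pos ht, ← Measure.integral_comp_div, abs_of_pos ht]
  simp [div_mul_cancel₀ _ ht.ne']

theorem hasDerivAt_integral_mul_comp_ray {η : ℝ → ℝ} {C : ℝ} (hη : Measurable η)
    (hηC : ∀ v, |η v| ≤ C) (hΦ : ContDiff ℝ 1 Φ) (hc : HasCompactSupport Φ) {t : ℝ} (ht : 0 < t) :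
    HasDerivAt (fun t => ∫ v, η v * Φ (v * t, t))
      (∫ v, η v * fderiv ℝ Φ (v * t, t) (v, 1)) t := by
  obtain ⟨R, hR⟩ := (hc.fderiv ℝ).isCompact.isBounded.subset_closedBall 0
  obtain ⟨M, hM⟩ := (hc.fderiv ℝ).exists_bound_of_continuous (hΦ.continuous_fderiv one_ne_zero)
  have hC : 0 ≤ C := (abs_nonneg _).trans (hηC 0)
  have hM0 : 0 ≤ M := (norm_nonneg _).trans (hM 0)
  have hloc : LocallyIntegrable η :=
    hη.locallyIntegrable_of_abs_le continuous_const hηC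
  refine (hasDerivAt_integral_of_dominated_loc_of_deriv_le (s := Ioi (t / 2))
    (F := fun t v => η v * Φ (v * t, t))
    (F' := fun t v => η v * fderiv ℝ Φ (v * t, t) (v, 1))
    (bound := (Icc (-(2 * R / t)) (2 * R / t)).indicator fun v => C * (M * (|v| + 1)))
    (Ioi_mem_nhds (half_lt_self ht)) ?_ ?_ ?_ ?_ ?_ ?_).2
  · refine Eventually.of_forall fun s => (hη.mul ?_).aestronglyMeasurable
    exact (hΦ.continuous.comp (by fun_prop)).measurable
  · exact hloc.integrable_smul_right_of_hasCompactSupport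
      (hΦ.continuous.comp (by fun_prop)) (hc.comp_ray ht.ne')
  · refine (hη.mul (Continuous.measurable ?_)).aestronglyMeasurable
    exact ((hΦ.continuous_fderiv one_ne_zero).comp (by fun_prop)).clm_apply (by fun_prop)
  · refine Eventually.of_forall fun v s hs => ?_
    have hs' : t / 2 < s := hs
    by_cases hv : v ∈ Icc (-(2 * R / t)) (2 * R / t)
    · rw [indicator_of_mem hv, norm_mul]
      refine mul_le_mul (hηC v) ?_ (norm_nonneg _) hC
      refine (ContinuousLinearMap.le_opNorm _ _).trans
        (mul_le_mul (hM _) ?_ (norm_nonneg _) hM0)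
      rw [Prod.norm_def]
      refine max_le ?_ ?_
      · simp
      · simp
    · have hz : fderiv ℝ Φ (v * s, s) = 0 := by
        by_contra hne
        have hmem := hR (subset_tsupport _ (Function.mem_support.2 hne))
        rw [mem_closedBall_zero_iff] at hmem
        have h1 : |v * s| ≤ R := (le_max_left _ _).trans hmem
        refine hv (abs_le.1 ?_)
        rw [le_div_iff₀ ht]
        rw [abs_mul, abs_of_pos ((half_pos ht).trans hs')] at h1
        nlinarith [abs_nonneg v]
      rw [indicator_of_notMem hv, hz]
      simp
  · refine IntegrableOn.integrable_indicator ?_ measurableSet_Icc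
    exact Continuous.integrableOn_Icc (by fun_prop)
  · refine Eventually.of_forall fun v s _ => ?_
    exact (hasDerivAt_comp_ray_right (hΦ.differentiable one_ne_zero) v s).const_mul _

theorem continuousAt_zero_integral_comp_div_mul {η : ℝ → ℝ} {C : ℝ} (hη : Measurable η)
    (hηC : ∀ v, |η v| ≤ C) (hΦ : Continuous Φ) (hc : HasCompactSupport Φ)
    (h0 : ∀ x, Φ (x, 0) = 0) :
    ContinuousAt (fun t => ∫ x, η (x / t) * Φ (x, t)) 0 := by
  obtain ⟨R, hR⟩ := hc.isCompact.isBounded.subset_closedBall 0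
  obtain ⟨M, hM⟩ := hc.exists_bound_of_continuous hΦ
  have hC : 0 ≤ C := (abs_nonneg _).trans (hηC 0)
  refine tendsto_integral_filter_of_dominated_convergence
    ((Icc (-R) R).indicator fun _ => C * M) ?_ ?_ ?_ ?_
  · refine Eventually.of_forall fun t => Measurable.aestronglyMeasurable ?_
    exact (hη.comp (measurable_id.div_const t)).mul
      (hΦ.comp (by fun_prop : Continuous fun x : ℝ => (x, t))).measurable
  · refine Eventually.of_forall fun t => Eventually.of_forall fun x => ?_
    by_cases hx : x ∈ Icc (-R) R
    · rw [indicator_of_mem hx, norm_mul]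
      exact mul_le_mul (hηC _) (hM _) (norm_nonneg _) hC
    · have hz : Φ (x, t) = 0 := by
        by_contra hne
        have hmem := hR (subset_tsupport _ (Function.mem_support.2 hne))
        rw [mem_closedBall_zero_iff] at hmem
        exact hx (abs_le.1 ((le_max_left _ _).trans hmem))
      rw [indicator_of_notMem hx, hz]
      simp
  · exact (integrable_indicator_iff measurableSet_Icc).2 continuous_const.integrableOn_Icc
  · refine Eventually.of_forall fun x => ?_
    have h1 : Tendsto (fun t => C * |Φ (x, t)|) (nhds 0) (nhds 0) := by
      have : Continuous fun t => C * |Φ (x, t)| :=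
        continuous_const.mul (hΦ.comp (by fun_prop : Continuous fun t : ℝ => (x, t))).abs
      simpa [h0] using this.tendsto 0
    rw [h0, mul_zero]
    refine squeeze_zero_norm (fun t => ?_) h1
    rw [norm_mul]
    exact mul_le_mul_of_nonneg_right (hηC _) (norm_nonneg _)

end SelfSimilar

theorem IsVariationalMinimizer.deriv_integral_le {lam rho c : ℝ} {G h : ℝ → ℝ} {L : NNReal}
    (hG : LipschitzOnWith L G (Icc lam rho)) (hh : IsVariationalMinimizer lam rho G h)
    (hc : c ∈ Icc lam rho) {Φ : ℝ × ℝ → ℝ} (hΦ : ContDiff ℝ 1 Φ) (hΦc : HasCompactSupport Φ)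
    (hΦ0 : ∀ p, 0 ≤ Φ p) {t : ℝ} (ht : 0 < t) :
    (∫ v, |h v - c| * Φ (v * t, t)) + t * ∫ v, |h v - c| * fderiv ℝ Φ (v * t, t) (v, 1) ≤
      ∫ x, (|h (x / t) - c| * fderiv ℝ Φ (x, t) (0, 1) +
        kruzkovFlux G c (h (x / t)) * fderiv ℝ Φ (x, t) (1, 0)) := by
  have hmeas : Measurable h := hh.1.measurable
  have hη : LocallyIntegrable fun v => |h v - c| :=
    (hmeas.sub_const c).abs.locallyIntegrable_of_abs_le (continuous_const (y := rho - lam))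
      fun v => by rw [abs_abs]; exact hh.abs_sub_le hc v
  have hq : LocallyIntegrable fun v => kruzkovFlux G c (h v) :=
    (measurable_kruzkovFlux_comp c hmeas (hh.measurable_comp hG)).locallyIntegrable_of_abs_le
      continuous_const (hh.abs_kruzkovFlux_le hG hc)
  have hcont : ∀ w : ℝ → ℝ × ℝ, Continuous w →
      Continuous fun v => fderiv ℝ Φ (v * t, t) (w v) := fun w hw =>
    ((hΦ.continuous_fderiv one_ne_zero).comp (by fun_prop)).clm_apply hw
  have hsupp : ∀ w : ℝ → ℝ × ℝ, HasCompactSupport fun v => fderiv ℝ Φ (v * t, t) (w v) :=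
    fun w => ((hΦc.fderiv ℝ).comp_ray ht.ne').mono fun v hv hv' => hv (by
      have h0 : fderiv ℝ Φ (v * t, t) = 0 := hv'
      simp [h0])
  have hηw : ∀ w : ℝ → ℝ × ℝ, Continuous w →
      Integrable fun v => |h v - c| * fderiv ℝ Φ (v * t, t) (w v) := fun w hw =>
    hη.integrable_smul_right_of_hasCompactSupport (hcont w hw) (hsupp w)
  have hqw : Integrable fun v => kruzkovFlux G c (h v) * fderiv ℝ Φ (v * t, t) (1, 0) :=
    hq.integrable_smul_right_of_hasCompactSupport (hcont _ continuous_const) (hsupp _)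
  have hscale : ∫ x, (|h (x / t) - c| * fderiv ℝ Φ (x, t) (0, 1) +
      kruzkovFlux G c (h (x / t)) * fderiv ℝ Φ (x, t) (1, 0)) =
      t * ∫ v, (|h v - c| * fderiv ℝ Φ (v * t, t) (0, 1) +
        kruzkovFlux G c (h v) * fderiv ℝ Φ (v * t, t) (1, 0)) := by
    rw [← smul_eq_mul, ← abs_of_pos ht, ← Measure.integral_comp_div, abs_of_pos ht]
    simp [div_mul_cancel₀ _ ht.ne']
  have hsum : Integrable fun v => |h v - c| * fderiv ℝ Φ (v * t, t) (0, 1) +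
      kruzkovFlux G c (h v) * fderiv ℝ Φ (v * t, t) (1, 0) :=
    (hηw (fun _ => (0, 1)) continuous_const).add hqw
  have hray : ContDiff ℝ 1 fun v => Φ (v * t, t) := hΦ.comp (by fun_prop)
  have hmain := hh.integral_mul_le hG hc hray (hΦc.comp_ray ht.ne') fun v => hΦ0 _
  have hsplit : ∫ v, (kruzkovFlux G c (h v) - v * |h v - c|) * deriv (fun v => Φ (v * t, t)) v =
      (t * ∫ v, (|h v - c| * fderiv ℝ Φ (v * t, t) (0, 1) +
        kruzkovFlux G c (h v) * fderiv ℝ Φ (v * t, t) (1, 0))) -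
      t * ∫ v, |h v - c| * fderiv ℝ Φ (v * t, t) (v, 1) := by
    rw [← mul_sub, ← integral_sub hsum (hηw (fun v => (v, 1)) (by fun_prop)),
      ← integral_const_mul]
    refine integral_congr_ae (Eventually.of_forall fun v => ?_)
    have h1 : ((v, 1) : ℝ × ℝ) = v • ((1, 0) : ℝ × ℝ) + (0, 1) := by simp
    beta_reduce
    rw [(hasDerivAt_comp_ray_left (hΦ.differentiable one_ne_zero) v t).deriv, h1, map_add,
      map_smul, smul_eq_mul]
    ring
  rw [hscale]
  linarith

theorem IsVariationalMinimizer.isEntropySolution {lam rho : ℝ} {G h : ℝ → ℝ} {L : NNReal}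
    (hG : LipschitzOnWith L G (Icc lam rho)) (hh : IsVariationalMinimizer lam rho G h) :
    IsEntropySolution lam rho G fun x t => h (x / t) := by
  intro c hc φ hφ hφc hφ0 hφpos
  set Φ : ℝ × ℝ → ℝ := fun p => φ p.1 p.2 with hΦdef
  have hΦ : ContDiff ℝ 1 Φ := hφ.of_le (by exact_mod_cast le_top)
  have hdiff : Differentiable ℝ Φ := hΦ.differentiable one_ne_zero
  have hdt : ∀ x t, deriv (fun s => φ x s) t = fderiv ℝ Φ (x, t) (0, 1) := fun x t =>
    (HasFDerivAt.comp_hasDerivAt (f := fun s => (x, s)) t (hdiff (x, t)).hasFDerivAt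
      ((hasDerivAt_const t x).prodMk (hasDerivAt_id t))).deriv
  have hdx : ∀ x t, deriv (fun y => φ y t) x = fderiv ℝ Φ (x, t) (1, 0) := fun x t =>
    (HasFDerivAt.comp_hasDerivAt (f := fun y => (y, t)) x (hdiff (x, t)).hasFDerivAt
      ((hasDerivAt_id x).prodMk (hasDerivAt_const x t))).deriv
  simp only [hdt, hdx, ← kruzkovFlux.eq_1]
  set J : ℝ → ℝ := fun t => ∫ x, (|h (x / t) - c| * fderiv ℝ Φ (x, t) (0, 1) +
    kruzkovFlux G c (h (x / t)) * fderiv ℝ Φ (x, t) (1, 0)) with hJ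
  change 0 ≤ ∫ t in Ioi 0, J t
  by_cases hJi : IntegrableOn J (Ioi 0)
  swap
  · rw [integral_undef hJi]
  obtain ⟨R, hR⟩ := hφc.isCompact.isBounded.subset_closedBall 0
  set T := max R 0 + 1
  have hT : 0 < T := by positivity
  have hsupp : ∀ x t, T ≤ t → (x, t) ∉ tsupport Φ := fun x t ht hmem => by
    have h1 := mem_closedBall_zero_iff.1 (hR hmem)
    have h2 : |t| ≤ R := (le_max_right _ _).trans h1
    linarith [le_abs_self t, le_max_left R 0]
  have hJ0 : ∀ t ∈ Ioi 0 \ Ioc 0 T, J t = 0 := fun t ht => by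
    have htT : T ≤ t := by
      by_contra! hlt
      exact ht.2 ⟨ht.1, hlt.le⟩
    have hz : ∀ x, fderiv ℝ Φ (x, t) = 0 := fun x =>
      image_eq_zero_of_notMem_tsupport fun hx => hsupp x t htT (tsupport_fderiv_subset ℝ hx)
    simp [hJ, hz]
  rw [setIntegral_eq_of_subset_of_forall_sdiff_eq_zero measurableSet_Ioi Ioc_subset_Ioi_self hJ0,
    ← intervalIntegral.integral_of_le hT.le]
  have hη : Measurable fun v => |h v - c| := (hh.1.measurable.sub_const c).abs
  have hηC : ∀ v, |(|h v - c|)| ≤ rho - lam := fun v => by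
    rw [abs_abs]
    exact hh.abs_sub_le hc v
  set E : ℝ → ℝ := fun t => ∫ x, |h (x / t) - c| * Φ (x, t) with hE
  have hEderiv : ∀ t, 0 < t → HasDerivAt E ((∫ v, |h v - c| * Φ (v * t, t)) +
      t * ∫ v, |h v - c| * fderiv ℝ Φ (v * t, t) (v, 1)) t := fun t ht => by
    have h1 := (hasDerivAt_id t).mul (hasDerivAt_integral_mul_comp_ray hη hηC hΦ hφc ht)
    rw [one_mul] at h1
    refine h1.congr_of_eventuallyEq ?_
    filter_upwards [Ioi_mem_nhds ht] with s hs
    exact integral_comp_div_mul (fun v => |h v - c|) hs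
  have hEcont : ContinuousOn E (Icc 0 T) := fun t ht => by
    rcases ht.1.eq_or_lt with rfl | hpos
    · exact (continuousAt_zero_integral_comp_div_mul hη hηC hΦ.continuous hφc
        fun x => hφ0 x 0 le_rfl).continuousWithinAt
    · exact (hEderiv t hpos).continuousAt.continuousWithinAt
  have hE0 : E 0 = 0 := by simp [hE, hΦdef, hφ0]
  have hET : E T = 0 := by
    have hz : ∀ x, Φ (x, T) = 0 := fun x =>
      image_eq_zero_of_notMem_tsupport (hsupp x T le_rfl)
    simp only [hE, hz, mul_zero, integral_zero]
  have := intervalIntegral.sub_le_integral_of_hasDeriv_right_of_le hT.le hEcont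
    (fun t ht => (hEderiv t ht.1).hasDerivWithinAt)
    ((integrableOn_Icc_iff_integrableOn_Ioc (by simp)).2 (hJi.mono_set Ioc_subset_Ioi_self))
    fun t ht => hh.deriv_integral_le hG hc hΦ hφc (fun p => hφpos _ _) ht.1
  rwa [hE0, hET, sub_zero] at this

/-- Variational formula for the entropy solution of the Riemann problem with left density
`lam` and right density `rho < lam`: there is a nondecreasing `h : ℝ → [lam, rho]` picking,
for all but countably many `v`, the unique minimizer of `G(·) − v ·` on `[lam, rho]`; and for
any such `h`, `u(x, t) := h (x / t)` is an entropy solution on `ℝ × (0, ∞)` assuming the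
Riemann initial datum `u₀ = lam 1_{x<0} + rho 1_{x≥0}` in `L¹_loc` as `t → 0⁺`. -/
theorem riemann_variational_solution (lam rho : ℝ) (hlr : lam < rho)
    (G : ℝ → ℝ) (L : NNReal) (hG : LipschitzOnWith L G (Set.Icc lam rho)) :
    (∃ h : ℝ → ℝ, IsVariationalMinimizer lam rho G h) ∧
    ∀ h : ℝ → ℝ, IsVariationalMinimizer lam rho G h →
      IsEntropySolution lam rho G (fun x t => h (x / t)) ∧
      ∀ A B : ℝ, Filter.Tendsto
        (fun t => ∫ x in Set.Icc A B, |h (x / t) - (if x < 0 then lam else rho)|)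
        (nhdsWithin 0 (Set.Ioi 0)) (nhds 0) := by
  refine ⟨exists_isVariationalMinimizer hlr.le hG.continuousOn, fun h hh => ?_⟩
  exact ⟨hh.isEntropySolution hG, hh.tendsto_initial hlr.le hG⟩
end

section
/- Let K ≥ 1 be an integer. Let R be a closed subset of [0, K] containing 0 and K, and let G : [0, K] → ℝ be a function which is concave, satisfies G(K − u) = G(u) for all u ∈ [0, K], is affine on the closure of every connected component of [0, K] ∖ R, and satisfies F(u) ≤ G(u) ≤ H(u) for all u ∈ [0, K], where F(u) = u(1−u) for 0 ≤ u ≤ 1/2, F(u) = 1/4 for 1/2 ≤ u ≤ K − 1/2, F(u) = (K−u)(1−(K−u)) for K − 1/2 ≤ u ≤ K, and H(u) = u/(1+u) for 0 ≤ u ≤ K/2, H(u) = (K−u)/(1+K−u) for K/2 ≤ u ≤ K. Then 0 and K are accumulation points of R. -/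
open Set

/-- `G` is affine on the closure of every connected component of `[0,K] ∖ R`:
whenever `a, b ∈ R`, `a < b` and the open interval `(a, b)` contains no point of `R`
(so that `(a,b)` is a connected component of the complement of `R`), `G` is affine
on `[a, b]`. -/
def AffineOnGaps (R : Set ℝ) (G : ℝ → ℝ) : Prop :=
  ∀ a b : ℝ, a ∈ R → b ∈ R → a < b → Set.Ioo a b ∩ R = ∅ →
    ∃ m q : ℝ, ∀ x ∈ Set.Icc a b, G x = m * x + q

/-- The lower bound `F` for the flux of the totally asymmetric `K`-exclusion process. -/
noncomputable def lowerBd (K : ℝ) (u : ℝ) : ℝ :=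
  if u ≤ 1 / 2 then u * (1 - u)
  else if u ≤ K - 1 / 2 then 1 / 4
  else (K - u) * (1 - (K - u))

/-- The upper bound `H` for the flux of the totally asymmetric `K`-exclusion process. -/
noncomputable def upperBd (K : ℝ) (u : ℝ) : ℝ :=
  if u ≤ K / 2 then u / (1 + u) else (K - u) / (1 + K - u)

/-- A closed set of nonnegative reals that contains `0` as an isolated point and some positive
point has a leftmost gap `(0, b)`. -/
lemma exists_gap_of_zero_isolated {R : Set ℝ} (hR : IsClosed R) (hnn : ∀ x ∈ R, 0 ≤ x)
    {c : ℝ} (hc : c ∈ R) (hc0 : 0 < c) (h0 : (0 : ℝ) ∉ closure (R \ {0})) :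
    ∃ b ∈ R, 0 < b ∧ Set.Ioo 0 b ∩ R = ∅ := by
  have hne : (R \ {0}).Nonempty := ⟨c, hc, hc0.ne'⟩
  have hbdd : BddBelow (R \ {0}) := ⟨0, fun x hx => hnn x hx.1⟩
  have hmem : sInf (R \ {0}) ∈ closure (R \ {0}) := csInf_mem_closure hne hbdd
  have hbR : sInf (R \ {0}) ∈ R := hR.closure_subset_iff.2 sdiff_subset hmem
  have hb0 : sInf (R \ {0}) ≠ 0 := fun h => h0 (by rwa [h] at hmem)
  refine ⟨_, hbR, (hnn _ hbR).lt_of_ne hb0.symm, ?_⟩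
  rw [Set.eq_empty_iff_forall_notMem]
  rintro x ⟨⟨hx0, hxb⟩, hxR⟩
  exact hxb.not_ge (csInf_le hbdd ⟨hxR, hx0.ne'⟩)

/-- A function lying between `lowerBd K` and `upperBd K` is not affine on any interval `[0, b]`. -/
lemma not_affine_near_zero_of_bounds {K : ℝ} (hK : 0 < K) {G : ℝ → ℝ}
    (hbounds : ∀ u ∈ Set.Icc 0 K, lowerBd K u ≤ G u ∧ G u ≤ upperBd K u)
    {b : ℝ} (hb : 0 < b) (m q : ℝ) : ¬ ∀ x ∈ Set.Icc 0 b, G x = m * x + q := by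
  intro haff
  have hlow : ∀ x, 0 ≤ x → x ≤ b → x ≤ K → x ≤ 1 / 2 → x * (1 - x) ≤ m * x + q := by
    intro x h0 hxb hxK hx
    have h := (hbounds x ⟨h0, hxK⟩).1
    rwa [haff x ⟨h0, hxb⟩, lowerBd, if_pos hx] at h
  have hupp : ∀ x, 0 ≤ x → x ≤ b → x ≤ K / 2 → m * x + q ≤ x / (1 + x) := by
    intro x h0 hxb hx
    have h := (hbounds x ⟨h0, by linarith⟩).2
    rwa [haff x ⟨h0, hxb⟩, upperBd, if_pos hx] at h
  have hq : 0 ≤ q := by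
    have := hlow 0 le_rfl hb.le hK.le (by norm_num)
    linarith
  have hq' : q ≤ 0 := by
    have := hupp 0 le_rfl hb.le (by linarith)
    norm_num at this
    exact this
  obtain rfl : q = 0 := le_antisymm hq' hq
  have hm : m < 1 := by
    obtain ⟨x, hx0, hx⟩ := exists_between (lt_min hb (half_pos hK))
    obtain ⟨hxb, hxK⟩ := lt_min_iff.1 hx
    have h := hupp x hx0.le hxb.le hxK.le
    rw [le_div_iff₀ (by linarith)] at h
    by_contra! hm
    nlinarith [mul_pos hx0 hx0, mul_nonneg (sub_nonneg.2 hm) hx0.le,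
      mul_nonneg (sub_nonneg.2 hm) (mul_pos hx0 hx0).le]
  obtain ⟨x, hx0, hx⟩ := exists_between
    (lt_min (lt_min hb hK) (lt_min (one_half_pos (α := ℝ)) (sub_pos.2 hm)))
  simp only [lt_min_iff] at hx
  obtain ⟨⟨hxb, hxK⟩, hx2, hxm⟩ := hx
  have h := hlow x hx0.le hxb.le hxK.le hx2.le
  nlinarith [mul_pos hx0 (sub_pos.2 hxm)]

lemma zero_mem_closure_diff_of_bounds {K : ℝ} (hK : 0 < K) {R : Set ℝ} (hR : IsClosed R)
    (hRsub : R ⊆ Set.Icc 0 K) (h0R : (0 : ℝ) ∈ R) (hKR : K ∈ R) {G : ℝ → ℝ}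
    (haff : AffineOnGaps R G)
    (hbounds : ∀ u ∈ Set.Icc 0 K, lowerBd K u ≤ G u ∧ G u ≤ upperBd K u) :
    (0 : ℝ) ∈ closure (R \ {0}) := by
  by_contra h0
  obtain ⟨b, hbR, hb, hgap⟩ :=
    exists_gap_of_zero_isolated hR (fun x hx => (hRsub hx).1) hKR hK h0
  obtain ⟨m, q, hmq⟩ := haff 0 b h0R hbR hb hgap
  exact not_affine_near_zero_of_bounds hK hbounds hb m q hmq

/-- Affinity on the gaps of `R` is inherited by the reflection of `R` when `G` is symmetric. -/
lemma AffineOnGaps.reflect {K : ℝ} {R : Set ℝ} (hRsub : R ⊆ Set.Icc 0 K) {G : ℝ → ℝ}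
    (hsym : ∀ u ∈ Set.Icc 0 K, G (K - u) = G u) (haff : AffineOnGaps R G) :
    AffineOnGaps ((fun x => K - x) ⁻¹' R) G := by
  intro a b ha hb hab hgap
  have hgap' : Set.Ioo (K - b) (K - a) ∩ R = ∅ := by
    rw [Set.eq_empty_iff_forall_notMem] at hgap ⊢
    rintro x ⟨⟨h1, h2⟩, hxR⟩
    exact hgap (K - x) ⟨⟨by linarith, by linarith⟩, by simpa using hxR⟩
  obtain ⟨m, q, hmq⟩ := haff (K - b) (K - a) hb ha (by linarith) hgap'
  refine ⟨-m, m * K + q, fun x hx => ?_⟩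
  have h1 := (hRsub ha).2
  have h2 := (hRsub hb).1
  rw [← hsym x ⟨by linarith [hx.1], by linarith [hx.2]⟩,
    hmq (K - x) ⟨by linarith [hx.2], by linarith [hx.1]⟩]
  ring

/-- First part of Corollary 2.1: for the totally asymmetric `K`-exclusion process,
`0` and `K` are accumulation points of the set `R` of densities of extremal
translation-invariant stationary measures. -/
theorem zero_and_K_accumulation_points (K : ℕ) (hK : 1 ≤ K)
    (R : Set ℝ) (hRclosed : IsClosed R) (hRsub : R ⊆ Set.Icc 0 (K : ℝ))
    (h0R : (0 : ℝ) ∈ R) (hKR : (K : ℝ) ∈ R)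
    (G : ℝ → ℝ) (hconc : ConcaveOn ℝ (Set.Icc 0 (K : ℝ)) G)
    (hsym : ∀ u ∈ Set.Icc 0 (K : ℝ), G ((K : ℝ) - u) = G u)
    (haff : AffineOnGaps R G)
    (hbounds : ∀ u ∈ Set.Icc 0 (K : ℝ), lowerBd K u ≤ G u ∧ G u ≤ upperBd K u) :
    (0 : ℝ) ∈ closure (R \ {0}) ∧ (K : ℝ) ∈ closure (R \ {(K : ℝ)}) := by
  have hK0 : (0 : ℝ) < K := by exact_mod_cast hK
  refine ⟨zero_mem_closure_diff_of_bounds hK0 hRclosed hRsub h0R hKR haff hbounds, ?_⟩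
  have hcont : Continuous fun x : ℝ => (K : ℝ) - x := by fun_prop
  have h := zero_mem_closure_diff_of_bounds hK0 (hRclosed.preimage hcont)
    (fun x hx => ⟨by linarith [(hRsub hx).2], by linarith [(hRsub hx).1]⟩)
    (by simpa using hKR) (by simpa using h0R) (haff.reflect hRsub hsym) hbounds
  have hmaps : Set.MapsTo (fun x : ℝ => (K : ℝ) - x)
      ((fun x : ℝ => (K : ℝ) - x) ⁻¹' R \ {0}) (R \ {(K : ℝ)}) :=
    fun x hx => ⟨hx.1, fun h => hx.2 (by simpa using h)⟩
  simpa using map_mem_closure hcont h hmaps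
end

section
/- Let K ≥ 1 be an integer. Let R be a closed subset of [0, K] containing 0 and K, and let G : [0, K] → ℝ be a function which is concave, satisfies G(K − u) = G(u) for all u ∈ [0, K], is affine on the closure of every connected component of [0, K] ∖ R, and satisfies F(u) ≤ G(u) ≤ H(u) for all u ∈ [0, K], where F(u) = u(1−u) for 0 ≤ u ≤ 1/2, F(u) = 1/4 for 1/2 ≤ u ≤ K − 1/2, F(u) = (K−u)(1−(K−u)) for K − 1/2 ≤ u ≤ K, and H(u) = u/(1+u) for 0 ≤ u ≤ K/2, H(u) = (K−u)/(1+K−u) for K/2 ≤ u ≤ K. Then R contains at least one point of the interval [1/3, K − 1/3]. -/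
open Set

/-- At the midpoint the lower bound equals `1 / 4`. -/
theorem lowerBd_half {K : ℝ} (hK : 1 ≤ K) : lowerBd K (K / 2) = 1 / 4 := by
  unfold lowerBd
  split_ifs with h₁ h₂
  · obtain rfl : K = 1 := by linarith
    norm_num
  · rfl
  · linarith

/-- The upper bound is below `1 / 4` to the left of `1 / 3`. -/
theorem upperBd_lt_quarter {K u : ℝ} (hK : 1 ≤ K) (hu₀ : 0 ≤ u) (hu : u < 1 / 3) :
    upperBd K u < 1 / 4 := by
  unfold upperBd
  rw [if_pos (by linarith), div_lt_iff₀ (by linarith)]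
  linarith

/-- A closed set containing points on both sides of `[s, t]` but missing `[s, t]` has a gap
containing `[s, t]`. -/
theorem exists_gap_of_disjoint_Icc {R : Set ℝ} (hR : IsClosed R) {x y s t : ℝ} (hx : x ∈ R)
    (hy : y ∈ R) (hxs : x ≤ s) (hty : t ≤ y) (hst : ∀ r ∈ R, r ∉ Set.Icc s t) :
    ∃ a ∈ R, ∃ b ∈ R, x ≤ a ∧ a ≤ s ∧ t ≤ b ∧ b ≤ y ∧ Set.Ioo a b ∩ R = ∅ := by
  obtain ⟨a, ⟨haR, hxa, has⟩, hmax⟩ :=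
    (isCompact_Icc.inter_left hR).exists_isGreatest ⟨x, hx, le_refl x, hxs⟩
  obtain ⟨b, ⟨hbR, htb, hby⟩, hmin⟩ :=
    (isCompact_Icc.inter_left hR).exists_isLeast ⟨y, hy, hty, le_refl y⟩
  refine ⟨a, haR, b, hbR, hxa, has, htb, hby, Set.eq_empty_iff_forall_notMem.2 ?_⟩
  rintro r ⟨⟨har, hrb⟩, hrR⟩
  rcases le_or_gt r s with hrs | hsr
  · exact har.not_ge (hmax ⟨hrR, hxa.trans har.le, hrs⟩)
  · rcases le_or_gt t r with htr | hrt
    · exact hrb.not_ge (hmin ⟨hrR, htr, hrb.le.trans hby⟩)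
    · exact hst r hrR ⟨hsr.le, hrt.le⟩

/-- Second part of Corollary 2.1: for the totally asymmetric `K`-exclusion process,
the set `R` of densities of extremal translation-invariant stationary measures
contains at least one point of `[1/3, K − 1/3]`. -/
theorem R_meets_middle_interval (K : ℕ) (hK : 1 ≤ K)
    (R : Set ℝ) (hRclosed : IsClosed R) (hRsub : R ⊆ Set.Icc 0 (K : ℝ))
    (h0R : (0 : ℝ) ∈ R) (hKR : (K : ℝ) ∈ R)
    (G : ℝ → ℝ) (hconc : ConcaveOn ℝ (Set.Icc 0 (K : ℝ)) G)
    (hsym : ∀ u ∈ Set.Icc 0 (K : ℝ), G ((K : ℝ) - u) = G u)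
    (haff : AffineOnGaps R G)
    (hbounds : ∀ u ∈ Set.Icc 0 (K : ℝ), lowerBd K u ≤ G u ∧ G u ≤ upperBd K u) :
    ∃ r ∈ R, r ∈ Set.Icc (1 / 3 : ℝ) ((K : ℝ) - 1 / 3) := by
  by_contra! hmiss
  have hK₁ : (1 : ℝ) ≤ K := by exact_mod_cast hK
  obtain ⟨a, haR, b, hbR, ha₀, ha, hb, hbK, hgap⟩ :=
    exists_gap_of_disjoint_Icc hRclosed h0R hKR (by norm_num) (by linarith) hmiss
  have ha' : a < 1 / 3 := lt_of_le_of_ne ha fun h => hmiss a haR ⟨h.ge, by linarith⟩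
  have hb' : (K : ℝ) - 1 / 3 < b := lt_of_le_of_ne hb fun h => hmiss b hbR ⟨by linarith, h.ge⟩
  obtain ⟨m, q, hG⟩ := haff a b haR hbR (by linarith) hgap
  obtain ⟨c, hac, hcb, hc⟩ : ∃ c : ℝ, a ≤ c ∧ (K : ℝ) - b ≤ c ∧ c < 1 / 3 :=
    ⟨max a (K - b), le_max_left _ _, le_max_right _ _, max_lt ha' (by linarith)⟩
  have hcK : c ∈ Set.Icc 0 (K : ℝ) := ⟨by linarith, by linarith⟩
  have hrefl := hsym c hcK
  have hGc := hG c ⟨hac, by linarith⟩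
  have hGc' := hG (K - c) ⟨by linarith, by linarith⟩
  have hGmid := hG (K / 2) ⟨by linarith, by linarith⟩
  have hmid : G (K / 2) = G c := by linarith
  have hlow := (hbounds (K / 2) ⟨by linarith, by linarith⟩).1
  rw [lowerBd_half hK₁] at hlow
  linarith [(hbounds c hcK).2, upperBd_lt_quarter hK₁ hcK.1 hc]
end

section
/- Let λ < ρ be real numbers, let G : [λ, ρ] → ℝ be continuous, and let G_c : [λ, ρ] → ℝ be the lower convex envelope of G. Then for every v ∈ ℝ: (i) the minimum over [λ, ρ] of α ↦ G(α) − vα equals the minimum over [λ, ρ] of α ↦ G_c(α) − vα; (ii) the set of global minimizers of α ↦ G_c(α) − vα on [λ, ρ] is a nonempty closed interval [a, b]; and (iii) a is the smallest global minimizer and b is the greatest global minimizer of α ↦ G(α) − vα on [λ, ρ]. -/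
open Set

/-- `Gc` is the lower convex envelope (greatest convex minorant) of `G` on `[lam, rho]`. -/
def IsLowerConvexEnvelope (lam rho : ℝ) (G Gc : ℝ → ℝ) : Prop :=
  ConvexOn ℝ (Set.Icc lam rho) Gc ∧
  (∀ x ∈ Set.Icc lam rho, Gc x ≤ G x) ∧
  ∀ h : ℝ → ℝ, ConvexOn ℝ (Set.Icc lam rho) h →
    (∀ x ∈ Set.Icc lam rho, h x ≤ G x) → ∀ x ∈ Set.Icc lam rho, h x ≤ Gc x

lemma IsCompact.exists_pos_mul_le_of_pos_of_nonneg {X : Type*} [TopologicalSpace X] {K : Set X}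
    (hK : IsCompact K) {F ℓ : X → ℝ} (hF : ContinuousOn F K) (hℓ : Continuous ℓ)
    (hF0 : ∀ z ∈ K, 0 ≤ F z) (hpos : ∀ z ∈ K, 0 ≤ ℓ z → 0 < F z) :
    ∃ ε > 0, ∀ z ∈ K, ε * ℓ z ≤ F z := by
  have hS : IsCompact (K ∩ {z | 0 ≤ ℓ z}) :=
    hK.inter_right (isClosed_le continuous_const hℓ)
  rcases (K ∩ {z | 0 ≤ ℓ z}).eq_empty_or_nonempty with hempty | hne
  · refine ⟨1, one_pos, fun z hz => ?_⟩
    have hneg : ¬ 0 ≤ ℓ z := fun h => eq_empty_iff_forall_notMem.1 hempty z ⟨hz, h⟩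
    linarith [hF0 z hz]
  · obtain ⟨p, hp, hpmin⟩ := hS.exists_isMinOn hne (hF.mono inter_subset_left)
    obtain ⟨q, hq, hqmax⟩ := hS.exists_isMaxOn hne hℓ.continuousOn
    have hδ : 0 < F p := hpos p hp.1 hp.2
    have hC : 0 < ℓ q + 1 := by linarith [show 0 ≤ ℓ q from hq.2]
    have hε : 0 < F p / (ℓ q + 1) := div_pos hδ hC
    refine ⟨F p / (ℓ q + 1), hε, fun z hz => ?_⟩
    by_cases h : 0 ≤ ℓ z
    · have hz1 : F p ≤ F z := hpmin ⟨hz, h⟩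
      have hz2 : ℓ z ≤ ℓ q := hqmax ⟨hz, h⟩
      calc F p / (ℓ q + 1) * ℓ z ≤ F p / (ℓ q + 1) * (ℓ q + 1) := by gcongr; linarith
        _ = F p := div_mul_cancel₀ _ hC.ne'
        _ ≤ F z := hz1
    · exact (mul_nonpos_of_nonneg_of_nonpos hε.le (not_le.mp h).le).trans (hF0 z hz)

namespace IsLowerConvexEnvelope

variable {lam rho : ℝ} {G Gc : ℝ → ℝ}

lemma affine_le (hGc : IsLowerConvexEnvelope lam rho G Gc) {c d : ℝ}
    (h : ∀ z ∈ Icc lam rho, c + d * z ≤ G z) : ∀ z ∈ Icc lam rho, c + d * z ≤ Gc z := by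
  refine hGc.2.2 (fun z => c + d * z) ⟨convex_Icc _ _, fun x _ y _ s t _ _ hst => ?_⟩ h
  simp only [smul_eq_mul]
  apply le_of_eq
  linear_combination (-c) * hst

/-- If every point where `G(·) - v·` attains a lower bound `m` lies in the open half-line
`c + d · < 0`, then the envelope exceeds `m + v·` on the opposite open half-line. -/
lemma lt_of_halfline (hGc : IsLowerConvexEnvelope lam rho G Gc)
    (hG : ContinuousOn G (Icc lam rho)) {v m c d : ℝ}
    (hm : ∀ z ∈ Icc lam rho, m ≤ G z - v * z)
    (hpos : ∀ z ∈ Icc lam rho, 0 ≤ c + d * z → m < G z - v * z)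
    {x : ℝ} (hx : x ∈ Icc lam rho) (hxpos : 0 < c + d * x) : m < Gc x - v * x := by
  obtain ⟨ε, hε, h⟩ := isCompact_Icc.exists_pos_mul_le_of_pos_of_nonneg
    (F := fun z => G z - v * z - m) (ℓ := fun z => c + d * z) (by fun_prop) (by fun_prop)
    (fun z hz => sub_nonneg.2 (hm z hz)) (fun z hz hz0 => sub_pos.2 (hpos z hz hz0))
  have hle := hGc.affine_le (c := m + ε * c) (d := v + ε * d)
    (fun z hz => by linarith [h z hz]) x hx
  nlinarith [mul_pos hε hxpos]

end IsLowerConvexEnvelope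

/-- Lemma 4.2: for every `v`, `G(·) − v·` and `G_c(·) − v·` have the same minimum value on
`[lam, rho]`; the set of global minimizers of `G_c(·) − v·` is a nonempty closed interval
`[a, b]`, and `a` (resp. `b`) is the smallest (resp. greatest) global minimizer of
`G(·) − v·` on `[lam, rho]`. -/
theorem convex_envelope_minimizers (lam rho : ℝ) (hlr : lam < rho)
    (G Gc : ℝ → ℝ) (hGcont : ContinuousOn G (Set.Icc lam rho))
    (hGc : IsLowerConvexEnvelope lam rho G Gc) (v : ℝ) :
    sInf ((fun α => G α - v * α) '' Set.Icc lam rho) =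
      sInf ((fun α => Gc α - v * α) '' Set.Icc lam rho) ∧
    ∃ a b : ℝ, a ≤ b ∧
      {α ∈ Set.Icc lam rho | ∀ β ∈ Set.Icc lam rho, Gc α - v * α ≤ Gc β - v * β} =
        Set.Icc a b ∧
      IsLeast {α ∈ Set.Icc lam rho | ∀ β ∈ Set.Icc lam rho, G α - v * α ≤ G β - v * β} a ∧
      IsGreatest {α ∈ Set.Icc lam rho | ∀ β ∈ Set.Icc lam rho, G α - v * α ≤ G β - v * β} b := by
  have hIne : (Icc lam rho).Nonempty := nonempty_Icc.2 hlr.le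
  have hF : ContinuousOn (fun α => G α - v * α) (Icc lam rho) := by fun_prop
  obtain ⟨p, hp, hpmin⟩ := isCompact_Icc.exists_isMinOn hIne hF
  obtain ⟨m, hm⟩ : ∃ m, m = G p - v * p := ⟨_, rfl⟩
  have hGm : ∀ z ∈ Icc lam rho, m ≤ G z - v * z := fun z hz => hm ▸ hpmin hz
  have hGcm : ∀ z ∈ Icc lam rho, m ≤ Gc z - v * z := fun z hz => by
    linarith [hGc.affine_le (c := m) (d := v) (fun y hy => by linarith [hGm y hy]) z hz]
  have hGcp : Gc p - v * p = m := by linarith [hGc.2.1 p hp, hGcm p hp]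
  have hGset : {α ∈ Icc lam rho | ∀ β ∈ Icc lam rho, G α - v * α ≤ G β - v * β} =
      {α ∈ Icc lam rho | G α - v * α ≤ m} := by
    ext α
    exact and_congr_right fun _ => ⟨fun h => hm ▸ h p hp, fun h β hβ => h.trans (hGm β hβ)⟩
  have hGcset : {α ∈ Icc lam rho | ∀ β ∈ Icc lam rho, Gc α - v * α ≤ Gc β - v * β} =
      {α ∈ Icc lam rho | Gc α - v * α ≤ m} := by
    ext α
    exact and_congr_right fun _ => ⟨fun h => hGcp ▸ h p hp, fun h β hβ => h.trans (hGcm β hβ)⟩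
  rw [hGset, hGcset]
  constructor
  · have h1 : IsLeast ((fun α => G α - v * α) '' Icc lam rho) m :=
      ⟨⟨p, hp, hm.symm⟩, forall_mem_image.2 hGm⟩
    have h2 : IsLeast ((fun α => Gc α - v * α) '' Icc lam rho) m :=
      ⟨⟨p, hp, hGcp⟩, forall_mem_image.2 hGcm⟩
    rw [h1.csInf_eq, h2.csInf_eq]
  have hcomp : IsCompact {α ∈ Icc lam rho | G α - v * α ≤ m} :=
    isCompact_Icc.of_isClosed_subset
      (hF.preimage_isClosed_of_isClosed isClosed_Icc isClosed_Iic) (sep_subset _ _)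
  have hne : {α ∈ Icc lam rho | G α - v * α ≤ m}.Nonempty := ⟨p, hp, hm.ge⟩
  obtain ⟨a, ha⟩ := hcomp.exists_isLeast hne
  obtain ⟨b, hb⟩ := hcomp.exists_isGreatest hne
  refine ⟨a, b, ha.2 hb.1, Subset.antisymm ?_ ?_, ha, hb⟩
  · rintro x ⟨hx, hxm⟩
    constructor
    · by_contra! hxa
      refine (hGc.lt_of_halfline hGcont (c := (x + a) / 2) (d := -1) hGm (fun z hz hz0 => ?_)
        hx (by linarith)).not_ge hxm
      by_contra! hzm
      linarith [ha.2 ⟨hz, hzm⟩]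
    · by_contra! hxb
      refine (hGc.lt_of_halfline hGcont (c := -((x + b) / 2)) (d := 1) hGm (fun z hz hz0 => ?_)
        hx (by linarith)).not_ge hxm
      by_contra! hzm
      linarith [hb.2 ⟨hz, hzm⟩]
  · have hconv : Convex ℝ {α ∈ Icc lam rho | Gc α - v * α ≤ m} := by
      refine ConvexOn.convex_le (f := fun α => Gc α - v * α) (hGc.1.sub ?_) m
      exact (LinearMap.mul ℝ ℝ v).concaveOn (convex_Icc _ _)
    exact hconv.ordConnected.out
      ⟨ha.1.1, by linarith [hGc.2.1 a ha.1.1, ha.1.2]⟩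
      ⟨hb.1.1, by linarith [hGc.2.1 b hb.1.1, hb.1.2]⟩
end

section
/- Let λ < ρ be real numbers, let G : [λ, ρ] → ℝ be continuous, and let G_c : [λ, ρ] → ℝ be the lower convex envelope of G. Let v ∈ ℝ and suppose the set of global minimizers of α ↦ G_c(α) − vα on [λ, ρ] is an interval [a, b] with a < b. Then G_c is affine with slope v on [a, b], G_c(a) = G(a), G_c(b) = G(b), and G_c(w) ≤ G(w) for all w ∈ [a, b]; that is, the graph of G_c between a and b is a chord of the graph of G with slope v lying below the graph of G. -/
open Set

/-- A convex envelope `Gc` touches `G` at a point `c` where a supporting line of slope `v` touches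
`Gc`, provided the contact is strict on one side of `c` (the left for `s = 1`, the right for
`s = -1`). -/
theorem IsLowerConvexEnvelope.eq_of_strict_side {lam rho : ℝ} {G Gc : ℝ → ℝ}
    (hGc : IsLowerConvexEnvelope lam rho G Gc) {v c s : ℝ} (hc : c ∈ Set.Icc lam rho)
    (hG : ContinuousWithinAt G (Set.Icc lam rho) c) (hs : s = 1 ∨ s = -1)
    (hsupp : ∀ x ∈ Set.Icc lam rho, Gc c + v * (x - c) ≤ Gc x)
    (hstrict : ∀ x ∈ Set.Icc lam rho, s * (x - c) < 0 → Gc c + v * (x - c) < Gc x) :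
    Gc c = G c := by
  obtain ⟨hconv, hle, hgreatest⟩ := hGc
  by_contra hne
  have hlt : Gc c < G c := lt_of_le_of_ne (hle c hc) hne
  have hss : s * s = 1 := by rcases hs with rfl | rfl <;> norm_num
  obtain ⟨ε, hε, hεG⟩ : ∃ ε > 0, Gc c + ε < G c := ⟨(G c - Gc c) / 2, by linarith, by linarith⟩
  obtain ⟨δ, hδ, hnear⟩ : ∃ δ > 0, ∀ x ∈ Set.Icc lam rho, |x - c| < δ →
      Gc c + v * (x - c) + ε < G x := by
    have hcont : ContinuousWithinAt (fun x => G x - v * (x - c)) (Set.Icc lam rho) c :=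
      hG.sub (by fun_prop)
    have hev := hcont.eventually_const_lt (u := Gc c + ε) (by simpa using hεG)
    obtain ⟨δ, hδ, h⟩ := Metric.mem_nhdsWithin_iff.1 hev
    refine ⟨δ, hδ, fun x hx hxc => ?_⟩
    have := h ⟨by simpa [Metric.mem_ball, Real.dist_eq] using hxc, hx⟩
    simp only [Set.mem_ofPred_eq] at this
    linarith
  set p : ℝ := c - s * δ with hp
  have hpc : s * (p - c) = -δ := by rw [hp]; linear_combination (-δ) * hss
  obtain ⟨η, hη, hηε, hηp⟩ : ∃ η > 0, 2 * η ≤ ε ∧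
      (p ∈ Set.Icc lam rho → Gc c + v * (p - c) + 2 * η ≤ Gc p) := by
    by_cases hpm : p ∈ Set.Icc lam rho
    · have hgap := hstrict p hpm (by linarith)
      refine ⟨min (ε / 2) ((Gc p - (Gc c + v * (p - c))) / 2), lt_min (by linarith) (by linarith),
        ?_, fun _ => ?_⟩
      · linarith [min_le_left (ε / 2) ((Gc p - (Gc c + v * (p - c))) / 2)]
      · linarith [min_le_right (ε / 2) ((Gc p - (Gc c + v * (p - c))) / 2)]
    · exact ⟨ε / 2, by linarith, by linarith, fun h => absurd h hpm⟩
  set k : ℝ := η / δ with hk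
  have hk0 : 0 < k := div_pos hη hδ
  have hkδ : k * δ = η := div_mul_cancel₀ _ hδ.ne'
  have hline : ConvexOn ℝ (Set.Icc lam rho)
      (fun x => Gc c + v * (x - c) + η - k * (s * (x - c))) := by
    refine ⟨convex_Icc _ _, fun x _ y _ t u _ _ htu => le_of_eq ?_⟩
    simp only [smul_eq_mul]
    linear_combination (-(Gc c - v * c + η + k * s * c)) * htu
  have hfar : ∀ x ∈ Set.Icc lam rho, s * (x - c) ≤ -δ →
      Gc c + v * (x - c) + η - k * (s * (x - c)) ≤ Gc x := by
    intro x hx hxc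
    set t : ℝ := -(s * (x - c)) with ht
    have ht0 : 0 < t := by linarith
    set r : ℝ := δ / t with hr
    have hr0 : 0 < r := div_pos hδ ht0
    have hr1 : r ≤ 1 := (div_le_one ht0).2 (by linarith)
    have hrt : r * t = δ := div_mul_cancel₀ _ ht0.ne'
    have hpcomb : (1 - r) * c + r * x = p := by
      rw [hp, ← hrt, ht]; linear_combination (-(r * (x - c))) * hss
    have hpm : p ∈ Set.Icc lam rho := by
      rw [← hpcomb]
      exact convex_Icc lam rho hc hx (by linarith) hr0.le (by ring)
    have hcv := hconv.2 hc hx (sub_nonneg.2 hr1) hr0.le (by ring)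
    simp only [smul_eq_mul] at hcv
    rw [hpcomb] at hcv
    have hgap := hηp hpm
    have hscaled : r * (Gc c + v * (x - c) + η - k * (s * (x - c))) ≤ r * Gc x := by
      have h1 : k * (r * t) = η := by rw [hrt, hkδ]
      have h2 : r * η ≤ η := by nlinarith
      have h3 : r * (k * (s * (x - c))) = -η := by rw [← h1, ht]; ring
      have h4 : v * (p - c) = r * (v * (x - c)) := by rw [← hpcomb]; ring
      linarith
    exact le_of_mul_le_mul_left hscaled hr0
  have hminor : ∀ x ∈ Set.Icc lam rho,
      Gc c + v * (x - c) + η - k * (s * (x - c)) ≤ G x := by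
    intro x hx
    rcases le_or_gt (s * (x - c)) (-δ) with h1 | h1
    · exact (hfar x hx h1).trans (hle x hx)
    rcases le_or_gt δ (s * (x - c)) with h2 | h2
    · have := mul_le_mul_of_nonneg_left h2 hk0.le
      linarith [hsupp x hx, hle x hx]
    · have habs : |x - c| < δ := by
        rw [abs_lt]
        rcases hs with rfl | rfl <;> constructor <;> linarith
      have := mul_le_mul_of_nonneg_left h1.le hk0.le
      linarith [hnear x hx habs]
  have := hgreatest _ hline hminor c hc
  simp only [sub_self, mul_zero] at this
  linarith

/-- Corollary 4.1(i): if the set of global minimizers of `G_c(·) − v·` on `[lam, rho]` is a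
nondegenerate interval `[a, b]`, then the graph of `G_c` between `a` and `b` is a chord of
the graph of `G` with slope `v` lying below the graph of `G`. -/
theorem envelope_flat_piece_is_chord (lam rho : ℝ) (hlr : lam < rho)
    (G Gc : ℝ → ℝ) (hGcont : ContinuousOn G (Set.Icc lam rho))
    (hGc : IsLowerConvexEnvelope lam rho G Gc) (v a b : ℝ) (hab : a < b)
    (hmin : {α ∈ Set.Icc lam rho | ∀ β ∈ Set.Icc lam rho, Gc α - v * α ≤ Gc β - v * β} =
      Set.Icc a b) :
    (∀ x ∈ Set.Icc a b, Gc x = Gc a + v * (x - a)) ∧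
    Gc a = G a ∧ Gc b = G b ∧ ∀ w ∈ Set.Icc a b, Gc w ≤ G w := by
  have hmem : ∀ x ∈ Set.Icc a b, x ∈ Set.Icc lam rho ∧
      ∀ β ∈ Set.Icc lam rho, Gc x - v * x ≤ Gc β - v * β := fun x hx => hmin.symm.subset hx
  obtain ⟨ha, hamin⟩ := hmem a (Set.left_mem_Icc.2 hab.le)
  obtain ⟨hb, hbmin⟩ := hmem b (Set.right_mem_Icc.2 hab.le)
  have hstrict : ∀ c ∈ Set.Icc a b, ∀ x ∈ Set.Icc lam rho, x ∉ Set.Icc a b →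
      Gc c + v * (x - c) < Gc x := by
    intro c hc x hx hxab
    by_contra! hle
    exact hxab (hmin.subset ⟨hx, fun β hβ => by linarith [(hmem c hc).2 β hβ]⟩)
  refine ⟨fun x hx => ?_, ?_, ?_, fun w hw => hGc.2.1 w (hmem w hw).1⟩
  · obtain ⟨hx', hxmin⟩ := hmem x hx
    linarith [hamin x hx', hxmin a ha]
  · exact hGc.eq_of_strict_side (v := v) (s := 1) ha (hGcont a ha) (Or.inl rfl)
      (fun x hx => by linarith [hamin x hx])
      (fun x hx hxa => hstrict a (Set.left_mem_Icc.2 hab.le) x hx fun h => by linarith [h.1])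
  · exact hGc.eq_of_strict_side (v := v) (s := -1) hb (hGcont b hb) (Or.inr rfl)
      (fun x hx => by linarith [hbmin x hx])
      (fun x hx hxb => hstrict b (Set.right_mem_Icc.2 hab.le) x hx fun h => by linarith [h.2])
end

section
/- Let λ < ρ be real numbers, let G : [λ, ρ] → ℝ be continuous, and let G_c : [λ, ρ] → ℝ be the lower convex envelope of G. Assume α ∈ [λ, ρ] satisfies G_c(α) = G(α). Then the restriction of G_c to [λ, α] is the lower convex envelope of the restriction of G to [λ, α], and the restriction of G_c to [α, ρ] is the lower convex envelope of the restriction of G to [α, ρ]. -/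
open Set

/-- `Gc` is the lower convex envelope (greatest convex minorant) of `G` on the interval `s`. -/
def IsLowerConvexEnvelopeOn (s : Set ℝ) (G Gc : ℝ → ℝ) : Prop :=
  ConvexOn ℝ s Gc ∧ (∀ x ∈ s, Gc x ≤ G x) ∧
  ∀ h : ℝ → ℝ, ConvexOn ℝ s h → (∀ x ∈ s, h x ≤ G x) → ∀ x ∈ s, h x ≤ Gc x

/-- Three-point form of convexity on a subset of the real line, without divisions. -/
theorem ConvexOn.sub_mul_le {s : Set ℝ} {f : ℝ → ℝ} (hf : ConvexOn ℝ s f) {x y z : ℝ}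
    (hx : x ∈ s) (hz : z ∈ s) (hxy : x ≤ y) (hyz : y ≤ z) :
    (z - x) * f y ≤ (z - y) * f x + (y - x) * f z := by
  rcases hxy.eq_or_lt with rfl | hxy
  · simp
  rcases hyz.eq_or_lt with rfl | hyz
  · simp
  have h := hf.slope_mono_adjacent hx hz hxy hyz
  rw [div_le_div_iff₀ (sub_pos.2 hxy) (sub_pos.2 hyz)] at h
  linarith

/-- Extending a convex majorant of a convex function `g` from `[a, b]` to `[a, c]` by `g` itself
gives a convex function, provided that the two functions agree at `b`. -/
theorem ConvexOn.ite_Icc {a b c : ℝ} {f g : ℝ → ℝ}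
    (hf : ConvexOn ℝ (Icc a b) f) (hg : ConvexOn ℝ (Icc a c) g)
    (hgf : ∀ x ∈ Icc a b, g x ≤ f x) (hfb : f b = g b) :
    ConvexOn ℝ (Icc a c) (fun x => if x ≤ b then f x else g x) := by
  have hle : ∀ x ∈ Icc a c, g x ≤ if x ≤ b then f x else g x := fun x hx => by
    split_ifs with h
    exacts [hgf x ⟨hx.1, h⟩, le_rfl]
  refine convexOn_of_slope_mono_adjacent (convex_Icc a c) fun {x y z} hx hz hxy hyz => ?_
  rw [div_le_div_iff₀ (sub_pos.2 hxy) (sub_pos.2 hyz)]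
  suffices h : (z - x) * (if y ≤ b then f y else g y) ≤
      (z - y) * (if x ≤ b then f x else g x) + (y - x) * (if z ≤ b then f z else g z) by
    linarith
  rcases lt_or_ge b y with hby | hyb
  · rw [if_neg hby.not_ge]
    have h := hg.sub_mul_le hx hz hxy.le hyz.le
    have hx' := mul_le_mul_of_nonneg_left (hle x hx) (sub_nonneg.2 hyz.le)
    have hz' := mul_le_mul_of_nonneg_left (hle z hz) (sub_nonneg.2 hxy.le)
    linarith
  have hxb : x ≤ b := hxy.le.trans hyb
  have hb : b ∈ Icc a b := ⟨hx.1.trans hxb, le_rfl⟩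
  rw [if_pos hyb, if_pos hxb]
  split_ifs with hzb
  · exact hf.sub_mul_le ⟨hx.1, hxb⟩ ⟨hz.1, hzb⟩ hxy.le hyz.le
  · have hl := hf.sub_mul_le ⟨hx.1, hxb⟩ hb hxy.le hyb
    have hr := hg.sub_mul_le hx hz hxb (not_le.1 hzb).le
    rw [hfb] at hl
    have hx' := mul_le_mul_of_nonneg_left (hgf x ⟨hx.1, hxb⟩) (sub_nonneg.2 (not_le.1 hzb).le)
    have hl' := mul_le_mul_of_nonneg_left hl (sub_nonneg.2 (hxy.trans hyz).le)
    have hr' := mul_le_mul_of_nonneg_left (hr.trans (add_le_add_left hx' _))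
      (sub_nonneg.2 hxy.le)
    refine le_of_mul_le_mul_left ?_ (sub_pos.2 (hxy.trans_le hyb))
    linarith

namespace IsLowerConvexEnvelopeOn

/-- At a point `b` of contact, the envelope on `[a, c]` restricts to the envelope on `[a, b]`. -/
theorem restrict_left {a b c : ℝ} {G Gc : ℝ → ℝ}
    (hGc : IsLowerConvexEnvelopeOn (Icc a c) G Gc) (hb : b ∈ Icc a c) (heq : Gc b = G b) :
    IsLowerConvexEnvelopeOn (Icc a b) G Gc := by
  obtain ⟨hconv, hle, hmax⟩ := hGc
  have hsub : Icc a b ⊆ Icc a c := Icc_subset_Icc_right hb.2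
  have hconv' := hconv.subset hsub (convex_Icc a b)
  refine ⟨hconv', fun x hx => hle x (hsub hx), fun h hh hhG x hx => ?_⟩
  have hhb : h b ≤ Gc b := heq ▸ hhG b ⟨hb.1, le_rfl⟩
  have key := hmax _ ((hh.sup hconv').ite_Icc hconv (fun _ _ => le_sup_right)
    (sup_eq_right.2 hhb)) (fun y hy => ?_) x (hsub hx)
  · rw [if_pos hx.2] at key
    exact le_sup_left.trans key
  · split_ifs with hyb
    exacts [sup_le (hhG y ⟨hy.1, hyb⟩) (hle y hy), hle y hy]

theorem comp_neg {s : Set ℝ} {G Gc : ℝ → ℝ} (hGc : IsLowerConvexEnvelopeOn s G Gc) :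
    IsLowerConvexEnvelopeOn (-s) (fun x => G (-x)) (fun x => Gc (-x)) := by
  have reflect : ∀ {t : Set ℝ} {f : ℝ → ℝ}, ConvexOn ℝ t f →
      ConvexOn ℝ (-t) (fun x => f (-x)) := fun hf => hf.comp_linearMap (-LinearMap.id)
  refine ⟨reflect hGc.1, fun x hx => hGc.2.1 (-x) hx, fun h hh hhG x hx => ?_⟩
  have hh' := reflect hh
  rw [neg_neg] at hh'
  simpa using hGc.2.2 _ hh' (fun y hy => by simpa using hhG (-y) (by simpa using hy)) (-x) hx

/-- At a point `b` of contact, the envelope on `[a, c]` restricts to the envelope on `[b, c]`. -/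
theorem restrict_right {a b c : ℝ} {G Gc : ℝ → ℝ}
    (hGc : IsLowerConvexEnvelopeOn (Icc a c) G Gc) (hb : b ∈ Icc a c) (heq : Gc b = G b) :
    IsLowerConvexEnvelopeOn (Icc b c) G Gc := by
  have h := hGc.comp_neg
  rw [Set.neg_Icc] at h
  have h' := (h.restrict_left (b := -b) ⟨neg_le_neg hb.2, neg_le_neg hb.1⟩
    (by simpa using heq)).comp_neg
  simpa using h'

end IsLowerConvexEnvelopeOn

/-- Corollary 4.1(iii): if `G_c(α) = G(α)` for some `α ∈ [lam, rho]`, then the restriction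
of `G_c` to `[lam, α]` (resp. `[α, rho]`) is the lower convex envelope of the restriction of
`G` to `[lam, α]` (resp. `[α, rho]`). -/
theorem envelope_splits_at_contact_point (lam rho : ℝ) (hlr : lam < rho)
    (G Gc : ℝ → ℝ) (hGcont : ContinuousOn G (Set.Icc lam rho))
    (hGc : IsLowerConvexEnvelopeOn (Set.Icc lam rho) G Gc)
    (α : ℝ) (hα : α ∈ Set.Icc lam rho) (heq : Gc α = G α) :
    IsLowerConvexEnvelopeOn (Set.Icc lam α) G Gc ∧
    IsLowerConvexEnvelopeOn (Set.Icc α rho) G Gc :=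
  ⟨hGc.restrict_left hα heq, hGc.restrict_right hα heq⟩
end

section
/- Let K > 0, let G : [0, K] → ℝ be Lipschitz continuous, and let u⁻, u⁺ ∈ [0, K] with u⁻ ≠ u⁺. Set s := (G(u⁺) − G(u⁻)) / (u⁺ − u⁻). Then the following are equivalent: (a) for every c ∈ [0, K], −s·(|u⁺ − c| − |u⁻ − c|) + sgn(u⁺ − c)·(G(u⁺) − G(c)) − sgn(u⁻ − c)·(G(u⁻) − G(c)) ≤ 0, where sgn(r) = 1 for r > 0, sgn(r) = −1 for r < 0, and sgn(0) = 0; (b) the pair (u⁻, u⁺) satisfies the Oleĭnik entropy condition. -/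
open Set

/-- Oleĭnik's entropy condition for a jump `(um, up)`: if `um < up` the chord of `G`
between `um` and `up` lies below the graph of `G`; if `up < um` it lies above. -/
def OleinikCondition (G : ℝ → ℝ) (um up : ℝ) : Prop :=
  (um < up → ∀ θ ∈ Set.Icc (0 : ℝ) 1,
    θ * G um + (1 - θ) * G up ≤ G (θ * um + (1 - θ) * up)) ∧
  (up < um → ∀ θ ∈ Set.Icc (0 : ℝ) 1,
    G (θ * um + (1 - θ) * up) ≤ θ * G um + (1 - θ) * G up)

/-- For an increasing jump, the Kružkov inequalities on an order-connected set containing both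
states say that the chord lies below the graph. -/
theorem kruzkov_jump_iff_chord_le {S : Set ℝ} [S.OrdConnected] (G : ℝ → ℝ) {a b : ℝ}
    (ha : a ∈ S) (hb : b ∈ S) (hab : a < b) :
    (∀ c ∈ S, -((G b - G a) / (b - a)) * (|b - c| - |a - c|)
        + Real.sign (b - c) * (G b - G c) - Real.sign (a - c) * (G a - G c) ≤ 0) ↔
      ∀ θ ∈ Set.Icc (0 : ℝ) 1, θ * G a + (1 - θ) * G b ≤ G (θ * a + (1 - θ) * b) := by
  have hd : b - a ≠ 0 := sub_ne_zero.mpr hab.ne'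
  obtain ⟨s, hs⟩ : ∃ s, s = (G b - G a) / (b - a) := ⟨_, rfl⟩
  have hslope : s * (b - a) = G b - G a := by rw [hs, div_mul_cancel₀ _ hd]
  rw [← hs]
  have between : ∀ c, a < c → c < b →
      -s * (|b - c| - |a - c|) + Real.sign (b - c) * (G b - G c)
        - Real.sign (a - c) * (G a - G c) = 2 * (G b - s * (b - c) - G c) := by
    intro c hac hcb
    rw [abs_of_pos (sub_pos.mpr hcb), abs_of_neg (sub_neg.mpr hac),
      Real.sign_of_pos (sub_pos.mpr hcb), Real.sign_of_neg (sub_neg.mpr hac)]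
    linear_combination hslope
  constructor
  · rintro h θ ⟨h0, h1⟩
    rcases h0.eq_or_lt with rfl | h0
    · simp
    rcases h1.eq_or_lt with rfl | h1
    · simp
    have hac : a < θ * a + (1 - θ) * b := by
      nlinarith [mul_pos (sub_pos.mpr h1) (sub_pos.mpr hab)]
    have hcb : θ * a + (1 - θ) * b < b := by nlinarith [mul_pos h0 (sub_pos.mpr hab)]
    have hJ := h _ (Set.Icc_subset S ha hb ⟨hac.le, hcb.le⟩)
    rw [between _ hac hcb] at hJ
    linear_combination hJ / 2 + θ * hslope
  · intro h c _
    rcases lt_trichotomy c a with hca | rfl | hac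
    · have hcb := hca.trans hab
      rw [abs_of_pos (sub_pos.mpr hcb), abs_of_pos (sub_pos.mpr hca),
        Real.sign_of_pos (sub_pos.mpr hcb), Real.sign_of_pos (sub_pos.mpr hca)]
      linear_combination -hslope
    · rw [abs_of_pos (sub_pos.mpr hab), Real.sign_of_pos (sub_pos.mpr hab)]
      simp only [sub_self, abs_zero, Real.sign_zero]
      linear_combination -hslope
    rcases lt_trichotomy c b with hcb | rfl | hbc
    · rw [between c hac hcb]
      have hθ := h ((b - c) / (b - a))
        ⟨div_nonneg (sub_nonneg.mpr hcb.le) (sub_nonneg.mpr hab.le),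
          (div_le_one (sub_pos.mpr hab)).mpr (by linarith)⟩
      have hc : (b - c) / (b - a) * (b - a) = b - c := div_mul_cancel₀ _ hd
      generalize (b - c) / (b - a) = θ at hθ hc
      rw [show θ * a + (1 - θ) * b = c by linear_combination -hc] at hθ
      linear_combination 2 * hθ + 2 * s * hc - 2 * θ * hslope
    · rw [abs_of_neg (sub_neg.mpr hab), Real.sign_of_neg (sub_neg.mpr hab)]
      simp only [sub_self, abs_zero, Real.sign_zero]
      linear_combination hslope
    · have hac := hab.trans hbc
      rw [abs_of_neg (sub_neg.mpr hbc), abs_of_neg (sub_neg.mpr hac),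
        Real.sign_of_neg (sub_neg.mpr hbc), Real.sign_of_neg (sub_neg.mpr hac)]
      linear_combination hslope

/-- Equivalence between the Kružkov jump inequalities along a discontinuity travelling at
the Rankine–Hugoniot speed `s = (G(u⁺) − G(u⁻))/(u⁺ − u⁻)` and Oleĭnik's entropy
condition for the pair `(u⁻, u⁺)`. -/
theorem kruzkov_jump_iff_oleinik (K : ℝ) (hK : 0 < K)
    (G : ℝ → ℝ) (L : NNReal) (hG : LipschitzOnWith L G (Set.Icc 0 K))
    (um up : ℝ) (hum : um ∈ Set.Icc 0 K) (hup : up ∈ Set.Icc 0 K) (hne : um ≠ up) :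
    (∀ c ∈ Set.Icc (0 : ℝ) K,
      -((G up - G um) / (up - um)) * (|up - c| - |um - c|)
        + Real.sign (up - c) * (G up - G c)
        - Real.sign (um - c) * (G um - G c) ≤ 0) ↔
    OleinikCondition G um up := by
  rcases hne.lt_or_gt with hlt | hlt
  · rw [kruzkov_jump_iff_chord_le G hum hup hlt]
    exact ⟨fun h => ⟨fun _ => h, fun h' => absurd h' hlt.asymm⟩, fun h => h.1 hlt⟩
  · have key := kruzkov_jump_iff_chord_le (fun x => -G x) hup hum hlt
    have slope : (-G um - -G up) / (um - up) = -((G up - G um) / (up - um)) := by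
      rw [← neg_sub up um, div_neg, neg_sub_neg]
    rw [slope] at key
    refine Iff.trans (forall₂_congr fun c _ => ?_) (key.trans ⟨fun h => ⟨fun h' =>
      absurd h' hlt.asymm, fun _ θ hθ => ?_⟩, fun h θ hθ => ?_⟩)
    · exact iff_of_eq (congrArg (· ≤ 0) (by ring))
    · have := h (1 - θ) ⟨by linarith [hθ.2], by linarith [hθ.1]⟩
      rw [sub_sub_cancel, add_comm ((1 - θ) * up)] at this
      linarith
    · have := h.2 hlt (1 - θ) ⟨by linarith [hθ.2], by linarith [hθ.1]⟩
      rw [sub_sub_cancel, add_comm ((1 - θ) * um)] at this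
      linarith
end

section
/- Let K > 0 and let R be a closed subset of [0, K] with 0 ∈ R. Let u : ℝ → [0, K] be a function with compact support and finite total variation such that u(x) ∈ R for almost every x ∈ ℝ. Then for every δ > 0 there exists ε₀ > 0 such that for every 0 < ε < ε₀ there exists a function v : ℝ → [0, K] with the following properties: v is piecewise constant with compact support, v takes all its values in R, every maximal interval on which v is constant has length at least ε, and Δ(v, u) ≤ εδ. -/
open MeasureTheory Set

/-- There is an `R`-valued step function on `[A, t)`, with steps of length at least `ε` and vanishing
elsewhere, whose primitive stays within `D` of the primitive of `u` up to `t`. -/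
def HasStepApprox (R : Set ℝ) (u : ℝ → ℝ) (A ε D t : ℝ) : Prop :=
  ∃ (v : ℝ → ℝ) (n : ℕ) (x : ℕ → ℝ) (r : ℕ → ℝ),
    Integrable v ∧ x 0 = A ∧ x n = t ∧
    (∀ i < n, x i + ε ≤ x (i + 1)) ∧
    (∀ i < n, r i ∈ R) ∧
    (∀ z : ℝ, z < A → v z = 0) ∧
    (∀ z : ℝ, t ≤ z → v z = 0) ∧
    (∀ i < n, ∀ z ∈ Ico (x i) (x (i + 1)), v z = r i) ∧
    ∀ z ≤ t, |∫ y in Iic z, (v y - u y)| ≤ D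

/-- Appending one step: the sign of the current error decides whether the new value lies above or
below `u`. -/
theorem HasStepApprox.append {R : Set ℝ} {u : ℝ → ℝ} {A ε ω s t a b : ℝ} (hu : Integrable u)
    (hε : 0 < ε) (hst : s + ε ≤ t) (hts : t - s ≤ 2 * ε) (ha : a ∈ R) (hb : b ∈ R)
    (hab : b - a ≤ ω) (hle : a ≤ b) (hub : ∀ᵐ y, y ∈ Ioo s t → u y ∈ Icc a b)
    (h : HasStepApprox R u A ε (ε * (2 * ω)) s) :
    HasStepApprox R u A ε (ε * (2 * ω)) t := by
  obtain ⟨v, n, x, r, hv, hx0, hxn, hgap, hr, hvA, hvs, hvr, herr⟩ := h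
  have hAx : ∀ i ≤ n, x i ≤ s := by
    intro i hi
    rw [← hxn]
    refine Nat.le_induction (P := fun m _ => m ≤ n → x i ≤ x m) (fun _ => le_rfl) ?_ n hi le_rfl
    intro m _ ih hm
    linarith [ih (by omega), hgap m hm]
  have hAs : A ≤ s := hx0 ▸ hAx 0 (Nat.zero_le _)
  set E := ∫ y in Iic s, (v y - u y) with hE
  obtain ⟨c, hcR, hc⟩ : ∃ c ∈ R, ∀ z ∈ Icc s t,
      |E + ∫ y in Ioc s z, (c - u y)| ≤ ε * (2 * ω) := by
    have hEabs := abs_le.1 (herr s le_rfl)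
    rw [← hE] at hEabs
    have hω : 0 ≤ ω := by linarith
    have hint : ∀ c z, IntegrableOn (fun y => c - u y) (Ioc s z) := fun c z =>
      (integrableOn_const (by simp)).sub hu.integrableOn
    have hub' : ∀ z ∈ Icc s t, ∀ᵐ y ∂volume.restrict (Ioc s z), u y ∈ Icc a b := by
      intro z hz
      rw [ae_restrict_iff' measurableSet_Ioc]
      have hne : ∀ᵐ y : ℝ, y ≠ t := by simp [ae_iff]
      filter_upwards [hub, hne] with y hy hyt hyz
      exact hy ⟨hyz.1, lt_of_le_of_ne (hyz.2.trans hz.2) hyt⟩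
    have hconst : ∀ z ∈ Icc s t, ∀ k : ℝ, ∫ _ in Ioc s z, k = (z - s) * k := by
      intro z hz k
      simp [hz.1]
    have hprod : ∀ z ∈ Icc s t, (z - s) * (b - a) ≤ ε * (2 * ω) := by
      intro z hz
      have h1 : z - s ≤ 2 * ε := by linarith [hz.2]
      have := mul_le_mul h1 hab (by linarith) (by linarith)
      linarith
    rcases le_total E 0 with hE0 | hE0
    · refine ⟨b, hb, fun z hz => ?_⟩
      have h0 : 0 ≤ ∫ y in Ioc s z, (b - u y) :=
        integral_nonneg_of_ae ((hub' z hz).mono fun y hy => sub_nonneg.2 hy.2)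
      have h1 : ∫ y in Ioc s z, (b - u y) ≤ ∫ _ in Ioc s z, (b - a) :=
        integral_mono_ae (hint b z) (integrableOn_const (by simp))
          ((hub' z hz).mono fun y hy => sub_le_sub_left hy.1 b)
      rw [hconst z hz] at h1
      rw [abs_le]
      constructor <;> linarith [hprod z hz]
    · refine ⟨a, ha, fun z hz => ?_⟩
      have h0 : ∫ y in Ioc s z, (a - u y) ≤ 0 :=
        integral_nonpos_of_ae ((hub' z hz).mono fun y hy => sub_nonpos.2 hy.1)
      have h1 : ∫ _ in Ioc s z, (a - b) ≤ ∫ y in Ioc s z, (a - u y) :=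
        integral_mono_ae (integrableOn_const (by simp)) (hint a z)
          ((hub' z hz).mono fun y hy => sub_le_sub_left hy.2 a)
      rw [hconst z hz] at h1
      rw [abs_le]
      constructor <;> linarith [hprod z hz]
  set w : ℝ → ℝ := fun z => v z + (Ico s t).indicator (fun _ => c) z with hw
  have hwlt : ∀ z < s, w z = v z := fun z hz => by simp [hw, hz]
  have hwmem : ∀ z ∈ Ico s t, w z = c := fun z hz => by
    simp only [hw, indicator_of_mem hz, hvs z hz.1, zero_add]
  have hwint : Integrable w :=
    hv.add ((integrable_indicator_iff measurableSet_Ico).2 (integrableOn_const (by simp)))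
  have hwle : ∀ z ≤ s, ∫ y in Iic z, (w y - u y) = ∫ y in Iic z, (v y - u y) := by
    intro z hz
    refine setIntegral_congr_ae measurableSet_Iic ?_
    have hne : ∀ᵐ y : ℝ, y ≠ s := by simp [ae_iff]
    filter_upwards [hne] with y hy hyz
    rw [hwlt y (lt_of_le_of_ne (le_trans hyz hz) hy)]
  refine ⟨w, n + 1, fun i => if i ≤ n then x i else t, fun i => if i < n then r i else c,
    hwint, by simp [hx0], by simp, ?_, ?_, ?_, ?_, ?_, ?_⟩
  · intro i hi
    rcases Nat.lt_succ_iff_lt_or_eq.1 hi with hi | rfl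
    · simpa [hi.le, Nat.succ_le_of_lt hi] using hgap i hi
    · simpa [hxn] using hst
  · intro i hi
    rcases Nat.lt_succ_iff_lt_or_eq.1 hi with hi | rfl
    · simpa [hi] using hr i hi
    · simpa using hcR
  · intro z hz
    rw [hwlt z (hz.trans_le hAs), hvA z hz]
  · intro z hz
    simp [hw, hvs z (by linarith), hz.not_gt]
  · intro i hi z hz
    rcases Nat.lt_succ_iff_lt_or_eq.1 hi with hi | rfl
    · simp only [hi.le, Nat.succ_le_of_lt hi, if_true] at hz
      rw [hwlt z (hz.2.trans_le (hAx _ hi)), hvr i hi z hz]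
      simp [hi]
    · rw [hwmem z (by simpa [hxn] using hz)]
      simp
  · intro z hz
    rcases le_total z s with hzs | hzs
    · rw [hwle z hzs]
      exact herr z hzs
    · have hwu : ∀ {S : Set ℝ}, IntegrableOn (fun y => w y - u y) S :=
        (hwint.sub hu).integrableOn
      have hsplit : ∫ y in Iic z, (w y - u y) = E + ∫ y in Ioc s z, (c - u y) := by
        rw [← Iic_union_Ioc_eq_Iic hzs, setIntegral_union
          (Iic_disjoint_Ioc le_rfl) measurableSet_Ioc hwu hwu, hwle s le_rfl]
        congr 1
        refine setIntegral_congr_ae measurableSet_Ioc ?_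
        have hne : ∀ᵐ y : ℝ, y ≠ t := by simp [ae_iff]
        filter_upwards [hne] with y hy hyz
        rw [hwmem y ⟨hyz.1.le, lt_of_le_of_ne (hyz.2.trans hz) hy⟩]
      rw [hsplit]
      exact hc z ⟨hzs, hz⟩

/-- Extending the approximation across an interval on which `u` oscillates little. -/
theorem HasStepApprox.extend {R : Set ℝ} {u : ℝ → ℝ} {A ε ω s t a b : ℝ} (hu : Integrable u)
    (hε : 0 < ε) (hst : s + ε ≤ t) (ha : a ∈ R) (hb : b ∈ R)
    (hab : b - a ≤ ω) (hle : a ≤ b) (hub : ∀ᵐ y, y ∈ Ioo s t → u y ∈ Icc a b)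
    (h : HasStepApprox R u A ε (ε * (2 * ω)) s) :
    HasStepApprox R u A ε (ε * (2 * ω)) t := by
  obtain ⟨n, hn⟩ : ∃ n : ℕ, t - s ≤ (n + 2) * ε := by
    obtain ⟨n, hn⟩ := exists_nat_ge ((t - s) / ε)
    exact ⟨n, by rw [div_le_iff₀ hε] at hn; linarith⟩
  induction n generalizing s with
  | zero => exact h.append hu hε hst (by simpa using hn) ha hb hab hle hub
  | succ n ih =>
    rcases le_total (t - s) (2 * ε) with hts | hts
    · exact h.append hu hε hst hts ha hb hab hle hub
    · refine ih (s := s + ε) (by linarith) ?_ ?_ (by push_cast at hn; linarith)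
      · filter_upwards [hub] with y hy hys
        exact hy ⟨by linarith [hys.1], hys.2⟩
      · refine h.append hu hε le_rfl (by linarith) ha hb hab hle ?_
        filter_upwards [hub] with y hy hys
        exact hy ⟨hys.1, by linarith [hys.2]⟩

theorem exists_forall_hasStepApprox_of_subset_Icc {R : Set ℝ} (hRclosed : IsClosed R)
    {u : ℝ → ℝ} (hu : Integrable u) (hR : ∀ᵐ x : ℝ, u x ∈ R) {A ω α s t : ℝ} (hst : s ≤ t)
    (huα : ∀ y ∈ Ioo s t, u y ∈ Icc α (α + ω)) :
    ∃ ε₀ > (0 : ℝ), ∀ ε, 0 < ε → ε < ε₀ →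
      HasStepApprox R u A ε (ε * (2 * ω)) s → HasStepApprox R u A ε (ε * (2 * ω)) t := by
  rcases hst.eq_or_lt with rfl | hst
  · exact ⟨1, one_pos, fun _ _ _ h => h⟩
  have hS : IsCompact (R ∩ Icc α (α + ω)) := isCompact_Icc.inter_left hRclosed
  have hmem : ∀ y ∈ Ioo s t, u y ∈ R → u y ∈ R ∩ Icc α (α + ω) :=
    fun y hy hyR => ⟨hyR, huα y hy⟩
  have hne : (R ∩ Icc α (α + ω)).Nonempty := by
    obtain ⟨y, hyR, hy⟩ := (Measure.dense_of_ae hR).exists_mem_open isOpen_Ioo (nonempty_Ioo.2 hst)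
    exact ⟨u y, hmem y hy hyR⟩
  obtain ⟨a, haS, ha⟩ := hS.exists_isLeast hne
  obtain ⟨b, hbS, hb⟩ := hS.exists_isGreatest hne
  refine ⟨t - s, sub_pos.2 hst, fun ε hε hlt h => h.extend hu hε (by linarith) haS.1 hbS.1
    (by linarith [haS.2.1, hbS.2.2]) (ha hbS) ?_⟩
  filter_upwards [hR] with y hyR hy
  exact ⟨ha (hmem y hy hyR), hb (hmem y hy hyR)⟩

/-- Extending the approximation across an interval on which the oscillation of `u` is controlled by
a bounded monotone function, by cutting it at the level sets of that function. -/
theorem exists_forall_hasStepApprox_of_monotone {R : Set ℝ} (hRclosed : IsClosed R)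
    {u : ℝ → ℝ} (hu : Integrable u) (hR : ∀ᵐ x : ℝ, u x ∈ R) {f : ℝ → ℝ} (hf : Monotone f)
    (huf : ∀ x y, x ≤ y → |u y - u x| ≤ f y - f x) {A η t : ℝ} (hη : 0 < η) (n : ℕ)
    {s α : ℝ} (hst : s ≤ t) (hα : ∀ y ∈ Ioo s t, f y ∈ Icc α (α + n * η)) :
    ∃ ε₀ > (0 : ℝ), ∀ ε, 0 < ε → ε < ε₀ →
      HasStepApprox R u A ε (ε * (2 * (2 * η))) s →
        HasStepApprox R u A ε (ε * (2 * (2 * η))) t := by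
  have small : ∀ {s t α : ℝ}, s ≤ t → (∀ y ∈ Ioo s t, f y ∈ Icc α (α + η)) →
      ∃ ε₀ > (0 : ℝ), ∀ ε, 0 < ε → ε < ε₀ →
      HasStepApprox R u A ε (ε * (2 * (2 * η))) s →
        HasStepApprox R u A ε (ε * (2 * (2 * η))) t := by
    intro s t α hst hα
    refine exists_forall_hasStepApprox_of_subset_Icc hRclosed hu hR
      (α := u ((s + t) / 2) - η) hst fun y hy => ?_
    have hm : (s + t) / 2 ∈ Ioo s t := ⟨by linarith [hy.1, hy.2], by linarith [hy.1, hy.2]⟩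
    have hd : |u y - u ((s + t) / 2)| ≤ η := by
      rcases le_total y ((s + t) / 2) with hle | hle
      · rw [abs_sub_comm]
        linarith [huf _ _ hle, (hα _ hm).2, (hα y hy).1]
      · linarith [huf _ _ hle, (hα _ hm).1, (hα y hy).2]
    rw [abs_le] at hd
    constructor <;> linarith
  induction n generalizing s α with
  | zero => exact small (α := α) hst fun y hy => ⟨(hα y hy).1, by
      have := (hα y hy).2; simp at this; linarith⟩
  | succ n ih =>
    obtain ⟨c, hsc, hct, hlow, hhigh⟩ : ∃ c, s ≤ c ∧ c ≤ t ∧ (∀ y ∈ Ioo s c, f y ≤ α + η) ∧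
        ∀ y ∈ Ioo c t, α + η ≤ f y := by
      set S := insert s {y ∈ Icc s t | f y ≤ α + η}
      have hSt : ∀ y ∈ S, y ≤ t := by
        rintro y (rfl | hy)
        exacts [hst, hy.1.2]
      have hbdd : BddAbove S := ⟨t, hSt⟩
      have hsS : s ∈ S := mem_insert _ _
      refine ⟨sSup S, le_csSup hbdd hsS, csSup_le ⟨s, hsS⟩ hSt, fun y hy => ?_, fun y hy => ?_⟩
      · obtain ⟨z, hz, hyz⟩ := exists_lt_of_lt_csSup ⟨s, hsS⟩ hy.2
        rcases hz with rfl | hz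
        · exact absurd hyz hy.1.not_gt
        · exact (hf hyz.le).trans hz.2
      · by_contra hlt
        have hsy : s ≤ y := (le_csSup hbdd hsS).trans hy.1.le
        exact (le_csSup hbdd (Or.inr ⟨⟨hsy, hy.2.le⟩, (not_le.1 hlt).le⟩)).not_gt hy.1
    obtain ⟨ε₁, hε₁, h₁⟩ := small (α := α) hsc
      fun y hy => ⟨(hα y ⟨hy.1, hy.2.trans_le hct⟩).1, hlow y hy⟩
    obtain ⟨ε₂, hε₂, h₂⟩ := ih (α := α + η) hct fun y hy => ⟨hhigh y hy, by
      have := (hα y ⟨hsc.trans_lt hy.1, hy.2⟩).2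
      push_cast at this
      linarith⟩
    exact ⟨min ε₁ ε₂, lt_min hε₁ hε₂, fun ε hε hlt h =>
      h₂ ε hε (hlt.trans_le (min_le_right _ _)) (h₁ ε hε (hlt.trans_le (min_le_left _ _)) h)⟩

/-- Lemma 5.5: a compactly supported function `u` of finite total variation taking values
a.e. in a closed set `R ∋ 0` can, for every `δ > 0` and every small enough `ε > 0`, be
approximated by a piecewise constant, compactly supported, `R`-valued function `v` with
step lengths at least `ε` and `Δ(v, u) ≤ ε δ`, where
`Δ(v, u) = sup_x |∫_{−∞}^x (v − u)|`. -/
theorem piecewise_constant_R_valued_approximation (K : ℝ) (hK : 0 < K)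
    (R : Set ℝ) (hRclosed : IsClosed R) (hRsub : R ⊆ Set.Icc 0 K) (h0R : (0 : ℝ) ∈ R)
    (u : ℝ → ℝ) (hmeas : Measurable u) (hrange : ∀ x, u x ∈ Set.Icc 0 K)
    (hsupp : HasCompactSupport u) (hBV : eVariationOn u Set.univ ≠ ⊤)
    (hR : ∀ᵐ x : ℝ, u x ∈ R) :
    ∀ δ > (0 : ℝ), ∃ ε₀ > (0 : ℝ), ∀ ε : ℝ, 0 < ε → ε < ε₀ →
      ∃ (v : ℝ → ℝ) (n : ℕ) (x : ℕ → ℝ) (r : ℕ → ℝ),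
        (∀ i < n, x i + ε ≤ x (i + 1)) ∧
        (∀ i < n, r i ∈ R) ∧
        (∀ z : ℝ, z < x 0 → v z = 0) ∧
        (∀ z : ℝ, x n ≤ z → v z = 0) ∧
        (∀ i < n, ∀ z ∈ Set.Ico (x i) (x (i + 1)), v z = r i) ∧
        ∀ z : ℝ, |∫ y in Set.Iic z, (v y - u y)| ≤ ε * δ := by
  intro δ hδ
  have hBV' : BoundedVariationOn u univ := hBV
  obtain ⟨p, q, hp, hq, hpq⟩ :=
    hBV'.locallyBoundedVariationOn.exists_monotoneOn_sub_monotoneOn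
  rw [monotoneOn_univ] at hp hq
  obtain ⟨M, hM⟩ := hsupp.isBounded.subset_closedBall 0
  have hu0 : ∀ y, M < |y| → u y = 0 := fun y hy => by
    by_contra hne
    have := hM (subset_tsupport u hne)
    rw [mem_closedBall_zero_iff, Real.norm_eq_abs] at this
    exact this.not_gt hy
  have hu : Integrable u := by
    refine (integrableOn_iff_integrable_of_support_subset (subset_tsupport u)).1 ?_
    refine Measure.integrableOn_of_bounded (M := K) hsupp.measure_lt_top.ne
      hmeas.aestronglyMeasurable (ae_of_all _ fun x => ?_)
    rw [Real.norm_eq_abs, abs_of_nonneg (hrange x).1]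
    exact (hrange x).2
  set B := |M| + 1
  have hMB : M < B := by linarith [le_abs_self M]
  have hB0 : 0 < B := by positivity
  have hη : 0 < δ / 4 := by positivity
  have hf : Monotone (p + q) := hp.add hq
  have huf : ∀ x y, x ≤ y → |u y - u x| ≤ (p + q) y - (p + q) x := by
    intro x y hxy
    simp only [hpq, Pi.sub_apply, Pi.add_apply]
    rw [abs_le]
    constructor <;> linarith [hp hxy, hq hxy]
  obtain ⟨n, hn⟩ := exists_nat_ge (((p + q) B - (p + q) (-B)) / (δ / 4))
  rw [div_le_iff₀ hη] at hn
  obtain ⟨ε₀, hε₀, h⟩ := exists_forall_hasStepApprox_of_monotone hRclosed hu hR hf huf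
    (A := -B) (s := -B) (t := B) (α := (p + q) (-B)) hη n (by linarith)
    fun y hy => ⟨hf hy.1.le, by linarith [hf hy.2.le]⟩
  refine ⟨ε₀, hε₀, fun ε hε hlt => ?_⟩
  have hδε : ε * (2 * (2 * (δ / 4))) = ε * δ := by ring
  obtain ⟨v, m, x, r, hv, hx0, hxm, hgap, hr, hvA, hvB, hvr, herr⟩ := h ε hε hlt
    ⟨0, 0, fun _ => -B, 0, integrable_zero _ _ _, rfl, rfl, by simp, by simp, by simp, by simp,
      by simp, fun z hz => by
        rw [setIntegral_eq_zero_of_forall_eq_zero]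
        · simpa using by positivity
        · intro y hy
          have hy' : M < |y| := by linarith [neg_le_abs y, mem_Iic.1 hy]
          simp [hu0 y hy']⟩
  rw [hδε] at herr
  refine ⟨v, m, x, r, hgap, hr, hx0 ▸ hvA, hxm ▸ hvB, hvr, fun z => ?_⟩
  rcases le_total z B with hz | hz
  · exact herr z hz
  · have hcut : ∫ y in Iic z, (v y - u y) = ∫ y in Iic B, (v y - u y) := by
      refine setIntegral_eq_of_subset_of_forall_sdiff_eq_zero measurableSet_Iic
        (Iic_subset_Iic.2 hz) fun y hy => ?_
      have hBy : B < y := not_le.1 hy.2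
      rw [hvB y hBy.le, hu0 y (by linarith [le_abs_self y]), sub_zero]
    rw [hcut]
    exact herr B le_rfl
end

section
/- Let K > 0 and Δx > 0. For a ∈ (−1, 1) and a measurable function v : ℝ → [0, K], define the sampled function T^a v : ℝ → [0, K] by T^a v(z) := v((j + a/2)Δx) for z ∈ ((j − 1/2)Δx, (j + 1/2)Δx), j ∈ ℤ. Then for all measurable functions v, w : ℝ → [0, K] and all real numbers x < y: (1/2) ∫_{−1}^{1} ( ∫_x^y |T^a v(z) − T^a w(z)| dz ) da ≤ ∫_{x − Δx}^{y + Δx} |v(z) − w(z)| dz. -/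
open MeasureTheory Set

/-- The Glimm sampling operator with space step `dx` and sampling parameter `a`:
`T^a v(z) := v((j + a/2) dx)` for `z` in the cell `((j − 1/2) dx, (j + 1/2) dx)`,
where `j = ⌊z/dx + 1/2⌋` is the index of the cell containing `z`. -/
noncomputable def sampled (dx a : ℝ) (v : ℝ → ℝ) (z : ℝ) : ℝ :=
  v ((((⌊z / dx + 1 / 2⌋ : ℤ) : ℝ) + a / 2) * dx)

/-- Averaging over the sampling parameter is averaging over the cell centred at `c * dx`. -/
lemma lintegral_sampling_parameter (dx : ℝ) (hdx : 0 < dx) (G : ℝ → ENNReal) (c : ℝ) :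
    ENNReal.ofReal (dx / 2) * ∫⁻ a in Ioo (-1 : ℝ) 1, G ((c + a / 2) * dx) =
      ∫⁻ t in Ioo ((c - 1 / 2) * dx) ((c + 1 / 2) * dx), G t := by
  have himage : (fun a : ℝ => (c + a / 2) * dx) '' Ioo (-1 : ℝ) 1 =
      Ioo ((c - 1 / 2) * dx) ((c + 1 / 2) * dx) := by
    ext t
    constructor
    · rintro ⟨a, ⟨h1, h2⟩, rfl⟩
      constructor <;> dsimp only <;> gcongr <;> linarith
    · rintro ⟨h1, h2⟩
      rw [← lt_div_iff₀ hdx] at h1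
      rw [← div_lt_iff₀ hdx] at h2
      refine ⟨2 * (t / dx - c), ⟨by linarith, by linarith⟩, ?_⟩
      field_simp
      ring
  have hderiv : ∀ a ∈ Ioo (-1 : ℝ) 1,
      HasDerivWithinAt (fun a : ℝ => (c + a / 2) * dx) (dx / 2) (Ioo (-1 : ℝ) 1) a := by
    intro a _
    have h := ((((hasDerivAt_id a).div_const 2).const_add c).mul_const dx).hasDerivWithinAt
      (s := Ioo (-1 : ℝ) 1)
    rwa [one_div_mul_eq_div] at h
  have hinj : InjOn (fun a : ℝ => (c + a / 2) * dx) (Ioo (-1 : ℝ) 1) := by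
    intro a _ b _ hab
    have := mul_right_cancel₀ hdx.ne' hab
    linarith
  rw [← himage, lintegral_image_eq_lintegral_abs_deriv_mul measurableSet_Ioo hderiv hinj,
    lintegral_const_mul' _ _ ENNReal.ofReal_ne_top, abs_of_pos (by positivity)]

/-- The points of the cell with index `n` form a half-open interval. -/
lemma setOf_cell_index_eq (dx : ℝ) (hdx : 0 < dx) (n : ℤ) :
    {z : ℝ | ⌊z / dx + 1 / 2⌋ = n} =
      Ico (((n : ℝ) - 1 / 2) * dx) (((n : ℝ) + 1 / 2) * dx) := by
  ext z
  rw [mem_ofPred_eq, Int.floor_eq_iff, mem_Ico, ← le_div_iff₀ hdx, ← div_lt_iff₀ hdx]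
  constructor <;> rintro ⟨h1, h2⟩ <;> constructor <;> linarith

/-- Integrating over `z ∈ (x, y]` the integral of `G` over the cell of `z` costs at most a factor
`dx` and an enlargement of the interval by `dx`. -/
lemma lintegral_lintegral_cell_le (dx : ℝ) (hdx : 0 < dx) (G : ℝ → ENNReal) (hG : Measurable G)
    (x y : ℝ) :
    ∫⁻ z in Ioc x y, ∫⁻ t in {t : ℝ | ⌊t / dx + 1 / 2⌋ = ⌊z / dx + 1 / 2⌋}, G t ≤
      ENNReal.ofReal dx * ∫⁻ t in Icc (x - dx) (y + dx), G t := by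
  have hcell : Measurable fun z : ℝ => ⌊z / dx + 1 / 2⌋ := by fun_prop
  have hset : MeasurableSet {p : ℝ × ℝ | ⌊p.2 / dx + 1 / 2⌋ = ⌊p.1 / dx + 1 / 2⌋} :=
    measurableSet_eq_fun (hcell.comp measurable_snd) (hcell.comp measurable_fst)
  have hmeas : Measurable fun p : ℝ × ℝ =>
      {p : ℝ × ℝ | ⌊p.2 / dx + 1 / 2⌋ = ⌊p.1 / dx + 1 / 2⌋}.indicator (fun p => G p.2) p :=
    (hG.comp measurable_snd).indicator hset
  have hslice (n : ℤ) : MeasurableSet {t : ℝ | ⌊t / dx + 1 / 2⌋ = n} :=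
    hcell (measurableSet_singleton n)
  calc
    _ = ∫⁻ z in Ioc x y, ∫⁻ t,
        {p : ℝ × ℝ | ⌊p.2 / dx + 1 / 2⌋ = ⌊p.1 / dx + 1 / 2⌋}.indicator
          (fun p => G p.2) (z, t) := by
      refine lintegral_congr fun z => ?_
      rw [← lintegral_indicator (hslice _)]
      rfl
    _ = ∫⁻ t, ∫⁻ z in Ioc x y,
        {p : ℝ × ℝ | ⌊p.2 / dx + 1 / 2⌋ = ⌊p.1 / dx + 1 / 2⌋}.indicator
          (fun p => G p.2) (z, t) := lintegral_lintegral_swap hmeas.aemeasurable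
    _ ≤ ∫⁻ t, ENNReal.ofReal dx * (Icc (x - dx) (y + dx)).indicator G t := by
      refine lintegral_mono fun t => ?_
      by_cases ht : t ∈ Icc (x - dx) (y + dx)
      · rw [indicator_of_mem ht]
        calc
          _ ≤ ∫⁻ z, {z : ℝ | ⌊z / dx + 1 / 2⌋ = ⌊t / dx + 1 / 2⌋}.indicator
              (fun _ => G t) z := by
            refine (setLIntegral_le_lintegral _ _).trans (lintegral_mono fun z => ?_)
            simp only [indicator, mem_ofPred_eq, eq_comm, le_refl]
          _ = ENNReal.ofReal dx * G t := by
            rw [lintegral_indicator (hslice _), setLIntegral_const,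
              setOf_cell_index_eq dx hdx, Real.volume_Ico, mul_comm]
            congr 2
            ring
      · rw [indicator_of_notMem ht, mul_zero, nonpos_iff_eq_zero]
        refine setLIntegral_eq_zero measurableSet_Ioc fun z hz => ?_
        refine indicator_of_notMem (fun h => ht ?_) _
        have hz' : z ∈ {s : ℝ | ⌊s / dx + 1 / 2⌋ = ⌊z / dx + 1 / 2⌋} := rfl
        have ht' : t ∈ {s : ℝ | ⌊s / dx + 1 / 2⌋ = ⌊z / dx + 1 / 2⌋} := h
        rw [setOf_cell_index_eq dx hdx] at hz' ht'
        constructor <;> linarith [hz.1, hz.2, hz'.1, hz'.2, ht'.1, ht'.2]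
    _ = _ := by
      rw [lintegral_const_mul' _ _ ENNReal.ofReal_ne_top, lintegral_indicator measurableSet_Icc]

/-- The averaged sampling estimate for a nonnegative measurable function. -/
lemma lintegral_lintegral_sampling_le (dx : ℝ) (hdx : 0 < dx) (G : ℝ → ENNReal)
    (hG : Measurable G) (x y : ℝ) :
    ∫⁻ a in Ioo (-1 : ℝ) 1, ∫⁻ z in Ioc x y,
        G ((((⌊z / dx + 1 / 2⌋ : ℤ) : ℝ) + a / 2) * dx) ≤
      2 * ∫⁻ t in Icc (x - dx) (y + dx), G t := by
  have hmeas : Measurable fun p : ℝ × ℝ =>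
      G ((((⌊p.2 / dx + 1 / 2⌋ : ℤ) : ℝ) + p.1 / 2) * dx) := by fun_prop
  have hpos : ENNReal.ofReal (dx / 2) ≠ 0 := by simpa using hdx
  rw [lintegral_lintegral_swap hmeas.aemeasurable,
    ← ENNReal.mul_le_mul_iff_right hpos ENNReal.ofReal_ne_top,
    ← lintegral_const_mul' _ _ ENNReal.ofReal_ne_top, ← mul_assoc]
  have htwo : ENNReal.ofReal (dx / 2) * 2 = ENNReal.ofReal dx := by
    rw [← ENNReal.ofReal_ofNat 2, ← ENNReal.ofReal_mul (by positivity)]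
    congr 1
    ring
  rw [htwo]
  refine le_trans (lintegral_mono fun z => ?_) (lintegral_lintegral_cell_le dx hdx G hG x y)
  dsimp only
  rw [lintegral_sampling_parameter dx hdx, setOf_cell_index_eq dx hdx]
  exact lintegral_mono_set Ioo_subset_Ico_self

/-- Inequality (46) of the paper: the Glimm sampling step is an `L¹`-contraction in
average over the sampling parameter `a` drawn uniformly from `(−1, 1)`, up to an
enlargement of the interval by `dx` on each side. -/
theorem sampling_average_contraction (K dx : ℝ) (hK : 0 < K) (hdx : 0 < dx)
    (v w : ℝ → ℝ) (hv : Measurable v) (hw : Measurable w)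
    (hvr : ∀ z, v z ∈ Set.Icc 0 K) (hwr : ∀ z, w z ∈ Set.Icc 0 K)
    (x y : ℝ) (hxy : x < y) :
    (1 / 2) * ∫ a in Set.Ioo (-1 : ℝ) 1,
        (∫ z in Set.Ioc x y, |sampled dx a v z - sampled dx a w z|) ≤
      ∫ z in Set.Icc (x - dx) (y + dx), |v z - w z| := by
  have hint : IntegrableOn (fun z => |v z - w z|) (Icc (x - dx) (y + dx)) := by
    refine Measure.integrableOn_of_bounded (M := K) measure_Icc_lt_top.ne
      (hv.sub hw).abs.aestronglyMeasurable (Filter.Eventually.of_forall fun z => ?_)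
    rw [Real.norm_eq_abs, abs_abs, abs_le]
    constructor <;> linarith [(hvr z).1, (hvr z).2, (hwr z).1, (hwr z).2]
  have hbound : ‖∫ a in Ioo (-1 : ℝ) 1,
      (∫ z in Ioc x y, |sampled dx a v z - sampled dx a w z|)‖ₑ ≤
      ENNReal.ofReal (2 * ∫ z in Icc (x - dx) (y + dx), |v z - w z|) := by
    calc
      _ ≤ ∫⁻ a in Ioo (-1 : ℝ) 1,
          ∫⁻ z in Ioc x y, ‖|sampled dx a v z - sampled dx a w z|‖ₑ :=
        (enorm_integral_le_lintegral_enorm _).trans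
          (lintegral_mono fun a => enorm_integral_le_lintegral_enorm _)
      _ ≤ 2 * ∫⁻ t in Icc (x - dx) (y + dx), ‖|v t - w t|‖ₑ :=
        lintegral_lintegral_sampling_le dx hdx (fun t => ‖|v t - w t|‖ₑ)
          (hv.sub hw).abs.enorm x y
      _ = _ := by
        rw [ENNReal.ofReal_mul zero_le_two, ENNReal.ofReal_ofNat,
          ← ofReal_integral_norm_eq_lintegral_enorm hint]
        simp only [Real.norm_eq_abs, abs_abs]
  have hnonneg : 0 ≤ ∫ z in Icc (x - dx) (y + dx), |v z - w z| :=
    integral_nonneg fun z => abs_nonneg _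
  rw [← ofReal_norm, ENNReal.ofReal_le_ofReal_iff (by positivity)] at hbound
  linarith [(Real.le_norm_self _).trans hbound]
end
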